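/- arXiv:1302.3060 — 3 statements merged into one kernel-verified Lean document; each statement's English description precedes it below -/
import Mathlib

section
/- Let σ = Ind_B^G(χ₁,χ₂) with χ₁/(ωχ₂) ≠ ω^{±1}, let τ = det(·)^m ⊗ Sym^n, and assume ρ = τ⊗σ (acting diagonally on V_τ ⊗_E V_σ) is an irreducible E[G]-module. Let v₁,…,v_r ∈ V_σ be such that Σ_{j=1}^{r} O_E[B]v_j spans V_σ over E, and set Λ = Σ_{i=0}^{n} Σ_{j=1}^{r} O_E[B](u^i ⊗ v_j) ⊆ V_τ ⊗ V_σ. Then Λ is commensurable with every nonzero cyclic O_E[G]-submodule of V_τ ⊗ V_σ: for every nonzero w ∈ V_τ ⊗ V_σ there exist nonzero c, c′ ∈ E with O_E[G]w ⊆ cΛ and Λ ⊆ c′·O_E[G]w. -/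
open scoped Classical
open Matrix

noncomputable section

namespace BS

variable (E : Type) [Field E]

/-- The ring of integers of a subfield `F` of `E`, with respect to a nonarchimedean
absolute value on `E`, as an additive subgroup of `F`. -/
def OFadd (abs : AbsoluteValue E ℝ)
    (na : ∀ x y : E, abs (x + y) ≤ max (abs x) (abs y))
    (F : Subfield E) : AddSubgroup F where
  carrier := {x | abs (x : E) ≤ 1}
  zero_mem' := by simp
  add_mem' := by
    intro a b ha hb
    simp only [Set.mem_setOf_eq] at *
    have h : ((a + b : F) : E) = (a : E) + (b : E) := by push_cast; ring
    rw [h]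
    exact le_trans (na _ _) (max_le ha hb)
  neg_mem' := by
    intro a ha
    simp only [Set.mem_setOf_eq] at *
    have h : ((-a : F) : E) = -(a : E) := by push_cast; ring
    rw [h, abs.map_neg]
    exact ha

/-- `W = F/O_F`. -/
abbrev Wq (abs : AbsoluteValue E ℝ)
    (na : ∀ x y : E, abs (x + y) ≤ max (abs x) (abs y))
    (F : Subfield E) : Type := F ⧸ OFadd E abs na F

/-- The canonical projection `F → W = F/O_F`. -/
def mkW (abs : AbsoluteValue E ℝ)
    (na : ∀ x y : E, abs (x + y) ≤ max (abs x) (abs y))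
    (F : Subfield E) : F →+ Wq E abs na F := QuotientAddGroup.mk' _

/-- Multiplication by `π` on `W = F/O_F`. -/
def pmulW (abs : AbsoluteValue E ℝ)
    (na : ∀ x y : E, abs (x + y) ≤ max (abs x) (abs y))
    (F : Subfield E) (π : F) (hπ : abs (π : E) ≤ 1) :
    Wq E abs na F →+ Wq E abs na F :=
  QuotientAddGroup.map _ _ (AddMonoidHom.mulLeft π) (by
    intro x hx
    simp only [AddSubgroup.mem_comap, AddMonoidHom.coe_mulLeft]
    show abs ((π * x : F) : E) ≤ 1
    have h : ((π * x : F) : E) = (π : E) * (x : E) := by push_cast; ring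
    rw [h, abs.map_mul]
    have hx' : abs (x : E) ≤ 1 := hx
    nlinarith [abs.nonneg (x : E), abs.nonneg (π : E)])


/-- Extension of a character `χ : F^× → E^×` to `F`, by `0` at `0`. -/
def extChar (F : Subfield E) (χ : Fˣ →* Eˣ) (x : F) : E :=
  if h : x = 0 then 0 else (χ (Units.mk0 x h) : E)

/-- A matrix over the subfield `F`, viewed over `E`. -/
def matE (F : Subfield E) (g : Matrix (Fin 2) (Fin 2) F) : Matrix (Fin 2) (Fin 2) E :=
  fun i j => (g i j : E)

/-- The rational representation `τ = det(·)^m ⊗ Sym^n` on `V_τ = E[u]^{≤n}`, realized on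
polynomials: `τ([[a,b],[c,d]])·u^i = (ad−bc)^m (a+cu)^{n−i} (b+du)^i`. -/
def tauPoly (m : ℤ) (n : ℕ) (g : Matrix (Fin 2) (Fin 2) E) (P : Polynomial E) :
    Polynomial E :=
  ((g 0 0 * g 1 1 - g 0 1 * g 1 0) ^ m) •
    ∑ i ∈ Finset.range (n + 1), P.coeff i •
      ((Polynomial.C (g 0 0) + Polynomial.C (g 1 0) * Polynomial.X) ^ (n - i) *
       (Polynomial.C (g 0 1) + Polynomial.C (g 1 1) * Polynomial.X) ^ i)

/-- Membership in `σ = Ind_B^G(χ₁,χ₂)`: `f : G → E` satisfies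
`f([[t₁,s],[0,t₂]]g) = χ₁(t₁)χ₂(t₂)f(g)` and is right-invariant under some (open) principal
congruence subgroup of `GL₂(O_F)`. -/
def IsIndFun (abs : AbsoluteValue E ℝ) (F : Subfield E) (π : F)
    (χ1 χ2 : Fˣ →* Eˣ) (f : GL (Fin 2) F → E) : Prop :=
  (∀ b : GL (Fin 2) F, (b : Matrix (Fin 2) (Fin 2) F) 1 0 = 0 →
    ∀ g : GL (Fin 2) F, f (b * g) =
      extChar E F χ1 ((b : Matrix (Fin 2) (Fin 2) F) 0 0) *
      extChar E F χ2 ((b : Matrix (Fin 2) (Fin 2) F) 1 1) * f g) ∧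
  (∃ N : ℕ, ∀ g h : GL (Fin 2) F,
    (∀ i j : Fin 2, abs ((((h : Matrix (Fin 2) (Fin 2) F) i j : F) : E) -
      (((1 : Matrix (Fin 2) (Fin 2) F) i j : F) : E)) ≤ abs (π : E) ^ N) →
    f (g * h) = f g)

/-- The locally algebraic representation `ρ = τ ⊗ σ` realized on functions
`G → V_τ = E[u]^{≤n}`: the element `v ⊗ f` of `V_τ ⊗_E V_σ` corresponds to the function
`g ↦ f(g)·v`, and `(ρ(g)Φ)(g′) = τ(g)(Φ(g′g))`. -/
def rhoAct (F : Subfield E) (m : ℤ) (n : ℕ)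
    (g : GL (Fin 2) F) (Φ : GL (Fin 2) F → Polynomial E) : GL (Fin 2) F → Polynomial E :=
  fun g' => tauPoly E m n (matE E F (g : Matrix (Fin 2) (Fin 2) F)) (Φ (g' * g))

/-- The space `V_ρ = V_τ ⊗_E V_σ`, realized as the span of the functions `g ↦ f(g)·v`
with `v ∈ E[u]^{≤n}` and `f ∈ V_σ`. -/
def Vrho (abs : AbsoluteValue E ℝ) (F : Subfield E) (π : F)
    (χ1 χ2 : Fˣ →* Eˣ) (n : ℕ) : Submodule E (GL (Fin 2) F → Polynomial E) :=
  Submodule.span E {Φ | ∃ (v : Polynomial E) (f : GL (Fin 2) F → E),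
    v.degree ≤ (n : WithBot ℕ) ∧ IsIndFun E abs F π χ1 χ2 f ∧ Φ = fun g => f g • v}

/-- The `O_E`-span of the translates, by elements of the set `{g : G | P g}`, of elements
of `S` — e.g. `O_E[B]·S` or `O_E[G]·S`. -/
def OESpan (abs : AbsoluteValue E ℝ) {G V : Type} [AddCommMonoid V] [Module E V]
    (act : G → V → V) (P : G → Prop) (S : Set V) : Set V :=
  {x | ∃ (k : ℕ) (c : Fin k → E) (b : Fin k → G) (w : Fin k → V),
    (∀ i, abs (c i) ≤ 1) ∧ (∀ i, P (b i)) ∧ (∀ i, w i ∈ S) ∧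
    x = ∑ i, c i • act (b i) (w i)}

/-- Right translation of functions on `G`, giving the `G`-action on `Ind_B^G(χ₁,χ₂)`. -/
def sigAct (F : Subfield E) (g : GL (Fin 2) F) (f : GL (Fin 2) F → E) :
    GL (Fin 2) F → E :=
  fun g' => f (g' * g)

section Lattice

variable {E}

/-- The ring of integers of `E`, as a subring. -/
def integerRing (abs : AbsoluteValue E ℝ)
    (na : ∀ x y : E, abs (x + y) ≤ max (abs x) (abs y)) : Subring E where
  carrier := {x | abs x ≤ 1}
  zero_mem' := by simp
  one_mem' := by simp
  add_mem' := fun {a b} ha hb => le_trans (na a b) (max_le ha hb)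
  neg_mem' := fun {a} ha => by simpa [abs.map_neg] using ha
  mul_mem' := fun {a b} ha hb => by
    simp only [Set.mem_ofPred_eq, abs.map_mul] at *
    exact mul_le_one₀ ha (abs.nonneg _) hb

variable {abs : AbsoluteValue E ℝ} {na : ∀ x y : E, abs (x + y) ≤ max (abs x) (abs y)}

theorem coe_OESpan {G V : Type} [AddCommGroup V] [Module E V]
    (act : G → V → V) (P : G → Prop) (S : Set V) :
    OESpan E abs act P S =
      (Submodule.span (integerRing abs na) {x | ∃ g, P g ∧ ∃ w ∈ S, x = act g w} : Set V) := by
  ext x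
  simp only [SetLike.mem_coe, Submodule.mem_span_set']
  constructor
  · rintro ⟨k, c, b, w, hc, hb, hw, rfl⟩
    exact ⟨k, fun i => ⟨c i, hc i⟩, fun i => ⟨act (b i) (w i), b i, hb i, w i, hw i, rfl⟩, rfl⟩
  · rintro ⟨k, c, y, rfl⟩
    choose b hb w hw hy using fun i => (y i).2
    exact ⟨k, fun i => c i, b, w, fun i => (c i).2, hb, hw,
      Finset.sum_congr rfl fun i _ => by rw [← hy i]; rfl⟩

variable {V : Type} [AddCommGroup V] [Module E V] {ϖ : E}

theorem smul_mem_of_abs_le_one (L : Submodule (integerRing abs na) V) {e : E} (he : abs e ≤ 1)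
    {x : V} (hx : x ∈ L) : e • x ∈ L :=
  L.smul_mem (⟨e, he⟩ : integerRing abs na) hx

theorem pow_smul_mem_of_le (h1 : abs ϖ < 1) (L : Submodule (integerRing abs na) V)
    {M N : ℕ} (hMN : M ≤ N) {x : V} (hx : ϖ ^ M • x ∈ L) : ϖ ^ N • x ∈ L := by
  obtain ⟨k, rfl⟩ := Nat.exists_eq_add_of_le' hMN
  rw [pow_add, mul_smul]
  refine smul_mem_of_abs_le_one L ?_ hx
  rw [map_pow]
  exact pow_le_one₀ (abs.nonneg _) h1.le

theorem exists_pow_mul_le (h1 : abs ϖ < 1) (C ε : ℝ) (hε : 0 < ε) :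
    ∃ N : ℕ, abs ϖ ^ N * C ≤ ε := by
  have h : Filter.Tendsto (fun N : ℕ => abs ϖ ^ N * C) Filter.atTop (nhds (0 * C)) :=
    (tendsto_pow_atTop_nhds_zero_of_lt_one (abs.nonneg _) h1).mul_const C
  rw [zero_mul] at h
  obtain ⟨N, hN⟩ := (h.eventually (ge_mem_nhds hε)).exists
  exact ⟨N, hN⟩

theorem exists_pow_smul_mem_of_mem_span (h1 : abs ϖ < 1) (T : Set V) {x : V}
    (hx : x ∈ Submodule.span E T) :
    ∃ N : ℕ, ϖ ^ N • x ∈ Submodule.span (integerRing abs na) T := by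
  induction hx using Submodule.span_induction with
  | mem x hx => exact ⟨0, by simpa using Submodule.subset_span hx⟩
  | zero => exact ⟨0, by simp⟩
  | add x y _ _ hx hy =>
    obtain ⟨M, hM⟩ := hx
    obtain ⟨N, hN⟩ := hy
    refine ⟨max M N, ?_⟩
    rw [smul_add]
    exact Submodule.add_mem _ (pow_smul_mem_of_le h1 _ (le_max_left _ _) hM)
      (pow_smul_mem_of_le h1 _ (le_max_right _ _) hN)
  | smul e x _ hx =>
    obtain ⟨M, hM⟩ := hx
    obtain ⟨N, hN⟩ := exists_pow_mul_le h1 (abs e) 1 one_pos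
    refine ⟨N + M, ?_⟩
    have : ϖ ^ (N + M) • e • x = (ϖ ^ N * e) • ϖ ^ M • x := by
      simp only [smul_smul]; ring_nf
    rw [this]
    exact smul_mem_of_abs_le_one _ (by simpa using hN) hM

theorem exists_pow_smul_mem_of_finite (h1 : abs ϖ < 1)
    (L : Submodule (integerRing abs na) V) {A : Set V} (hA : A.Finite)
    (h : ∀ x ∈ A, ∃ N : ℕ, ϖ ^ N • x ∈ L) : ∃ N : ℕ, ∀ x ∈ A, ϖ ^ N • x ∈ L := by
  induction A, hA using Set.Finite.induction_on with
  | empty => exact ⟨0, by simp⟩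
  | @insert a s _ _ ih =>
    obtain ⟨M, hM⟩ := ih fun x hx => h x (Set.mem_insert_of_mem _ hx)
    obtain ⟨N, hN⟩ := h a (Set.mem_insert _ _)
    refine ⟨max M N, ?_⟩
    rintro x (rfl | hx)
    · exact pow_smul_mem_of_le h1 L (le_max_right _ _) hN
    · exact pow_smul_mem_of_le h1 L (le_max_left _ _) (hM x hx)

end Lattice

section Tau

variable {E}

open Polynomial in
theorem tauPoly_eq_aeval (m : ℤ) (n : ℕ) (g : Matrix (Fin 2) (Fin 2) E) (P : E[X]) :
    tauPoly E m n g P = ((g 0 0 * g 1 1 - g 0 1 * g 1 0) ^ m) •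
      MvPolynomial.aeval ![C (g 0 1) + C (g 1 1) * X, C (g 0 0) + C (g 1 0) * X]
        (P.homogenize n) := by
  rw [tauPoly, homogenize, Finset.Nat.sum_antidiagonal_eq_sum_range_succ_mk, map_sum]
  congr 1
  refine Finset.sum_congr rfl fun i _ => ?_
  rw [MvPolynomial.aeval_monomial, Finsupp.update_eq_add_single (by simp),
    Finsupp.prod_add_index' (by simp) (fun _ _ _ => pow_add _ _ _),
    Finsupp.prod_single_index (by simp), Finsupp.prod_single_index (by simp), smul_eq_C_mul]
  simp only [Matrix.cons_val_zero, Matrix.cons_val_one, Polynomial.algebraMap_eq]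
  ring

theorem tauPoly_add (m : ℤ) (n : ℕ) (g : Matrix (Fin 2) (Fin 2) E) (P Q : Polynomial E) :
    tauPoly E m n g (P + Q) = tauPoly E m n g P + tauPoly E m n g Q := by
  simp only [tauPoly_eq_aeval, Polynomial.homogenize_add, map_add, smul_add]

theorem tauPoly_smul (m : ℤ) (n : ℕ) (g : Matrix (Fin 2) (Fin 2) E) (e : E) (P : Polynomial E) :
    tauPoly E m n g (e • P) = e • tauPoly E m n g P := by
  rw [tauPoly_eq_aeval, tauPoly_eq_aeval, Polynomial.homogenize_smul, map_smul, smul_comm]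

/-- `tauPoly` as a linear map. -/
def tauLin (m : ℤ) (n : ℕ) (g : Matrix (Fin 2) (Fin 2) E) : Polynomial E →ₗ[E] Polynomial E where
  toFun := tauPoly E m n g
  map_add' := tauPoly_add m n g
  map_smul' := tauPoly_smul m n g

open Polynomial in
theorem tauPoly_X_pow (m : ℤ) {n i : ℕ} (hi : i ≤ n) (g : Matrix (Fin 2) (Fin 2) E) :
    tauPoly E m n g (X ^ i) = ((g 0 0 * g 1 1 - g 0 1 * g 1 0) ^ m) •
      ((C (g 0 1) + C (g 1 1) * X) ^ i * (C (g 0 0) + C (g 1 0) * X) ^ (n - i)) := by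
  rw [tauPoly_eq_aeval, homogenize_X_pow hi]
  simp

open Polynomial in
theorem eqOn_degree_le {n : ℕ} {f g : E[X] →ₗ[E] E[X]} (h : ∀ i ≤ n, f (X ^ i) = g (X ^ i))
    {P : E[X]} (hP : P.degree ≤ n) : f P = g P := by
  have hP' : P ∈ degreeLE E n := mem_degreeLE.2 hP
  rw [degreeLE_eq_span_X_pow] at hP'
  refine LinearMap.eqOn_span (s := _) ?_ hP'
  intro x hx
  simp only [Finset.coe_image, Set.mem_image, Finset.coe_range, Set.mem_Iio] at hx
  obtain ⟨i, hi, rfl⟩ := hx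
  exact h i (by omega)

open Polynomial in
theorem tauPoly_mul (m : ℤ) (n : ℕ) (g h : Matrix (Fin 2) (Fin 2) E) {P : E[X]}
    (hP : P.degree ≤ n) :
    tauPoly E m n (g * h) P = tauPoly E m n g (tauPoly E m n h P) := by
  refine eqOn_degree_le (f := tauLin m n (g * h)) (g := tauLin m n g ∘ₗ tauLin m n h) ?_ hP
  intro i hi
  show tauPoly E m n (g * h) (X ^ i) = tauPoly E m n g (tauPoly E m n h (X ^ i))
  have hlin : ∀ a b : E, (C a + C b * X : E[X]).natDegree ≤ 1 := fun a b => by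
    rw [add_comm]; exact natDegree_linear_le
  have hpow : ∀ (a b : E) (k : ℕ), ((C a + C b * X : E[X]) ^ k).homogenize k =
      ((C a + C b * X : E[X]).homogenize 1) ^ k := fun a b k => by
    have := homogenize_finsetProd (s := Finset.range k) (p := fun _ => (C a + C b * X : E[X]))
      (n := fun _ => 1) (fun _ _ => hlin a b)
    simpa using this
  rw [tauPoly_X_pow m hi, tauPoly_X_pow m hi, tauPoly_smul, tauPoly_eq_aeval m n g]
  have key : ((C (h 0 1) + C (h 1 1) * X : E[X]) ^ i *
      (C (h 0 0) + C (h 1 0) * X) ^ (n - i)).homogenize n =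
      ((C (h 0 1) + C (h 1 1) * X : E[X]).homogenize 1) ^ i *
      ((C (h 0 0) + C (h 1 0) * X : E[X]).homogenize 1) ^ (n - i) := by
    have := homogenize_mul ((C (h 0 1) + C (h 1 1) * X : E[X]) ^ i)
      ((C (h 0 0) + C (h 1 0) * X) ^ (n - i)) (m := i) (n := n - i)
      (natDegree_pow_le_of_le i (hlin _ _) |>.trans (by omega))
      (natDegree_pow_le_of_le (n - i) (hlin _ _) |>.trans (by omega))
    rw [hpow, hpow, Nat.add_sub_cancel' hi] at this
    exact this
  rw [key, smul_smul, ← mul_zpow]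
  simp only [homogenize_add, homogenize_C_mul, homogenize_C, homogenize_X one_ne_zero, map_mul,
    map_pow, map_add, Matrix.mul_apply, Fin.sum_univ_two, pow_one, MvPolynomial.aeval_X,
    MvPolynomial.algHom_C, Polynomial.algebraMap_eq, Matrix.cons_val_zero, Matrix.cons_val_one,
    tsub_self, pow_zero, mul_one]
  congr 1
  · congr 1; ring
  · congr 2 <;> ring

theorem tauPoly_one (m : ℤ) (n : ℕ) {P : Polynomial E} (hP : P.degree ≤ n) :
    tauPoly E m n 1 P = P := by
  refine eqOn_degree_le (f := tauLin m n 1) (g := LinearMap.id) ?_ hP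
  intro i hi
  show tauPoly E m n 1 (Polynomial.X ^ i) = Polynomial.X ^ i
  rw [tauPoly_X_pow m hi]
  simp

open Polynomial in
theorem degree_tauPoly_le (m : ℤ) (n : ℕ) (g : Matrix (Fin 2) (Fin 2) E) (P : E[X]) :
    (tauPoly E m n g P).degree ≤ n := by
  rw [tauPoly, ← mem_degreeLE]
  refine Submodule.smul_mem _ _ (Submodule.sum_mem _ fun i hi => Submodule.smul_mem _ _ ?_)
  rw [mem_degreeLE, ← natDegree_le_iff_degree_le]
  have hlin : ∀ a b : E, (C a + C b * X : E[X]).natDegree ≤ 1 := fun a b => by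
    rw [add_comm]; exact natDegree_linear_le
  have h1 := natDegree_pow_le_of_le (n - i) (hlin (g 0 0) (g 1 0))
  have h2 := natDegree_pow_le_of_le i (hlin (g 0 1) (g 1 1))
  have := natDegree_mul_le_of_le h1 h2
  have := Finset.mem_range.1 hi
  omega

open Polynomial in
theorem eq_sum_range_smul_X_pow {n : ℕ} {P : E[X]} (hP : P.degree ≤ n) :
    P = ∑ i : Fin (n + 1), P.coeff i • (X : E[X]) ^ (i : ℕ) := by
  rw [Fin.sum_univ_eq_sum_range (fun i => P.coeff i • (X : E[X]) ^ i)]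
  conv_lhs => rw [P.as_sum_range_C_mul_X_pow' (n := n + 1)
    (Nat.lt_succ_of_le (natDegree_le_iff_degree_le.2 hP))]
  simp [smul_eq_C_mul]

open Polynomial in
theorem abs_coeff_tauPoly_X_pow_le {abs : AbsoluteValue E ℝ}
    (na : ∀ x y : E, abs (x + y) ≤ max (abs x) (abs y))
    (m : ℤ) {n i : ℕ} (hi : i ≤ n) {g : Matrix (Fin 2) (Fin 2) E}
    (hg : ∀ a b, abs (g a b) ≤ 1) (hdet : abs (g 0 0 * g 1 1 - g 0 1 * g 1 0) = 1) (k : ℕ) :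
    abs ((tauPoly E m n g (X ^ i)).coeff k) ≤ 1 := by
  rw [tauPoly_X_pow m hi, coeff_smul, smul_eq_mul, map_mul, map_zpow₀, hdet, _root_.one_zpow, one_mul]
  have hlin : ∀ a b : E, abs a ≤ 1 → abs b ≤ 1 →
      (C a + C b * X : E[X]) ∈ liftsRing (integerRing abs na).subtype := fun a b ha hb =>
    ⟨C ⟨a, ha⟩ + C ⟨b, hb⟩ * X, by simp⟩
  have h := (liftsRing (integerRing abs na).subtype).mul_mem
    (pow_mem (hlin _ _ (hg 0 1) (hg 1 1)) i) (pow_mem (hlin _ _ (hg 0 0) (hg 1 0)) (n - i))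
  obtain ⟨Q, hQ⟩ := h
  rw [← hQ, Polynomial.coe_mapRingHom, Polynomial.coeff_map]
  exact (Q.coeff k).2

end Tau

section Group

variable {E}

theorem matE_mul (F : Subfield E) (g h : Matrix (Fin 2) (Fin 2) F) :
    matE E F (g * h) = matE E F g * matE E F h := by
  ext i j
  simp [matE, Matrix.mul_apply]

theorem matE_one (F : Subfield E) : matE E F 1 = 1 := by
  ext i j
  fin_cases i <;> fin_cases j <;> simp [matE]

variable {abs : AbsoluteValue E ℝ}

theorem abs_mul_apply_le (na : ∀ x y : E, abs (x + y) ≤ max (abs x) (abs y)) {F : Subfield E}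
    {A B : Matrix (Fin 2) (Fin 2) F} {a b : ℝ} (hA : ∀ i j, abs (A i j : E) ≤ a)
    (hB : ∀ i j, abs (B i j : E) ≤ b) (i j : Fin 2) :
    abs (((A * B) i j : F) : E) ≤ a * b := by
  have ha : 0 ≤ a := (abs.nonneg _).trans (hA 0 0)
  have h : ∀ k, abs ((A i k : E) * (B k j : E)) ≤ a * b := fun k => by
    rw [map_mul]
    exact mul_le_mul (hA i k) (hB k j) (abs.nonneg _) ha
  rw [Matrix.mul_apply, Fin.sum_univ_two]
  push_cast
  exact (na _ _).trans (max_le (h 0) (h 1))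

theorem exists_abs_apply_le (F : Subfield E) (A : Matrix (Fin 2) (Fin 2) F) :
    ∃ a : ℝ, ∀ i j, abs (A i j : E) ≤ a := by
  obtain ⟨a, ha⟩ := (Set.finite_range fun p : Fin 2 × Fin 2 => abs (A p.1 p.2 : E)).bddAbove
  exact ⟨a, fun i j => ha ⟨(i, j), rfl⟩⟩

theorem IsIndFun.sigAct (na : ∀ x y : E, abs (x + y) ≤ max (abs x) (abs y)) {F : Subfield E}
    {π : F} (hπ0 : π ≠ 0) (hπ1 : abs (π : E) < 1) {χ1 χ2 : Fˣ →* Eˣ} {f : GL (Fin 2) F → E}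
    (hf : IsIndFun E abs F π χ1 χ2 f) (k : GL (Fin 2) F) :
    IsIndFun E abs F π χ1 χ2 (sigAct E F k f) := by
  obtain ⟨hB, N, hN⟩ := hf
  refine ⟨fun b hb g => ?_, ?_⟩
  · simp only [BS.sigAct]
    rw [mul_assoc b g k]
    exact hB b hb (g * k)
  obtain ⟨a, ha⟩ := exists_abs_apply_le (abs := abs) F ((k⁻¹ : GL (Fin 2) F) : Matrix _ _ F)
  obtain ⟨c, hc⟩ := exists_abs_apply_le (abs := abs) F (k : Matrix (Fin 2) (Fin 2) F)
  have hpos : 0 < abs (π : E) := abs.pos (by simpa using hπ0)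
  obtain ⟨M, hM⟩ := exists_pow_mul_le hπ1 (a * c) (abs (π : E) ^ N) (by positivity)
  refine ⟨M, fun g h hh => ?_⟩
  have hkey : g * h * k = g * k * (k⁻¹ * h * k) := by group
  simp only [BS.sigAct]
  rw [hkey]
  refine hN _ _ fun i j => ?_
  have hmat : ((k⁻¹ * h * k : GL (Fin 2) F) : Matrix (Fin 2) (Fin 2) F) - 1 =
      ((k⁻¹ : GL (Fin 2) F) : Matrix (Fin 2) (Fin 2) F) *
        ((h : Matrix (Fin 2) (Fin 2) F) - 1) * (k : Matrix (Fin 2) (Fin 2) F) := by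
    rw [mul_sub, sub_mul, mul_one, Units.val_mul, Units.val_mul, ← Units.val_mul k⁻¹ k,
      inv_mul_cancel, Units.val_one]
  have h1 := abs_mul_apply_le na (abs_mul_apply_le na ha
    (B := (h : Matrix (Fin 2) (Fin 2) F) - 1) (b := abs (π : E) ^ M)
    (fun i j => by simpa using hh i j)) hc i j
  rw [← hmat] at h1
  calc _ = abs (((((k⁻¹ * h * k : GL (Fin 2) F) : Matrix (Fin 2) (Fin 2) F) - 1) i j : F) : E) := by
        rw [Matrix.sub_apply]; push_cast; rfl
    _ ≤ a * abs (π : E) ^ M * c := h1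
    _ = abs (π : E) ^ M * (a * c) := by ring
    _ ≤ _ := hM

/-- Representatives in `GL₂(O_F)` (for `x` integral) of the Bruhat cells of `B \ GL₂(F)`:
`[[1,0],[x,1]]` and `[[0,1],[1,x]]`. -/
def cellRep (F : Subfield E) (s : Bool) (x : F) : GL (Fin 2) F :=
  if s then ⟨!![1, 0; x, 1], !![1, 0; -x, 1], by simp [Matrix.one_fin_two],
    by simp [Matrix.one_fin_two]⟩
  else ⟨!![0, 1; 1, x], !![-x, 1; 1, 0], by simp [Matrix.one_fin_two],
    by simp [Matrix.one_fin_two]⟩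

theorem abs_cellRep_apply_le {F : Subfield E} (s : Bool) {x : F} (hx : abs (x : E) ≤ 1)
    (i j : Fin 2) : abs (matE E F (cellRep F s x : Matrix (Fin 2) (Fin 2) F) i j) ≤ 1 := by
  cases s <;> fin_cases i <;> fin_cases j <;> simp [cellRep, matE, hx]

theorem abs_det_cellRep (F : Subfield E) (s : Bool) (x : F) :
    abs (matE E F (cellRep F s x : Matrix (Fin 2) (Fin 2) F) 0 0 *
        matE E F (cellRep F s x : Matrix (Fin 2) (Fin 2) F) 1 1 -
      matE E F (cellRep F s x : Matrix (Fin 2) (Fin 2) F) 0 1 *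
        matE E F (cellRep F s x : Matrix (Fin 2) (Fin 2) F) 1 0) = 1 := by
  cases s <;> simp [cellRep, matE]

theorem abs_cellRep_inv_mul_sub_one_le (F : Subfield E) (s : Bool) (x y : F) (i j : Fin 2) :
    abs (((((cellRep F s x)⁻¹ * cellRep F s y : GL (Fin 2) F) : Matrix (Fin 2) (Fin 2) F) i j : E) -
      (((1 : Matrix (Fin 2) (Fin 2) F) i j : F) : E)) ≤ abs ((y : E) - x) := by
  have h : (0 : ℝ) ≤ abs ((y : E) - x) := abs.nonneg _
  cases s <;> fin_cases i <;> fin_cases j <;>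
    simp [cellRep, Matrix.mul_apply, Fin.sum_univ_two, ← sub_eq_neg_add, h]

theorem exists_eq_borel_mul_cellRep (abs : AbsoluteValue E ℝ) (F : Subfield E)
    (g : GL (Fin 2) F) : ∃ (b : GL (Fin 2) F) (s : Bool) (x : F),
      (b : Matrix (Fin 2) (Fin 2) F) 1 0 = 0 ∧ abs (x : E) ≤ 1 ∧ g = b * cellRep F s x := by
  set c := (g : Matrix (Fin 2) (Fin 2) F) 1 0 with hc
  set d := (g : Matrix (Fin 2) (Fin 2) F) 1 1 with hd
  have hdet : c ≠ 0 ∨ d ≠ 0 := by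
    by_contra! h
    have h1 := (Matrix.isUnit_iff_isUnit_det _).1 g.isUnit
    rw [Matrix.det_fin_two, ← hc, ← hd, h.1, h.2] at h1
    simp at h1
  rcases le_or_gt (abs (c : E)) (abs (d : E)) with hcd | hcd
  · have hd0 : d ≠ 0 := by
      rintro h0
      rw [h0] at hcd
      have : (c : E) = 0 := abs.eq_zero.1 (le_antisymm (by simpa using hcd) (abs.nonneg _))
      have : c = 0 := by exact_mod_cast this
      tauto
    refine ⟨g * (cellRep F true (c / d))⁻¹, true, c / d, ?_, ?_, by group⟩
    · simp [cellRep, Matrix.mul_apply, Fin.sum_univ_two, ← hc, ← hd]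
      field_simp
      ring
    · push_cast
      rw [map_div₀]
      exact div_le_one_of_le₀ hcd (abs.nonneg _)
  · have hc0 : c ≠ 0 := by
      rintro h0
      rw [h0] at hcd
      simp at hcd
      exact absurd hcd (not_lt.2 (abs.nonneg _))
    refine ⟨g * (cellRep F false (d / c))⁻¹, false, d / c, ?_, ?_, by group⟩
    · simp [cellRep, Matrix.mul_apply, Fin.sum_univ_two, ← hc, ← hd]
      field_simp
      ring
    · push_cast
      rw [map_div₀]
      exact div_le_one_of_le₀ hcd.le (abs.nonneg _)

theorem exists_finite_approx {na : ∀ x y : E, abs (x + y) ≤ max (abs x) (abs y)}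
    {F : Subfield E} {π : F} (hπ0 : π ≠ 0) (hπ1 : abs (π : E) < 1)
    (hfin : Finite {β : Wq E abs na F // pmulW E abs na F π hπ1.le β = 0}) (N : ℕ) :
    ∃ R : Set F, R.Finite ∧
      ∀ x : F, abs (x : E) ≤ 1 → ∃ r ∈ R, abs ((x : E) - r) ≤ abs (π : E) ^ N := by
  have hpos : 0 < abs (π : E) := abs.pos (by simpa using hπ0)
  have hπE : (π : E) ≠ 0 := by simpa using hπ0
  have hone : ∃ R : Set F, R.Finite ∧
      ∀ x : F, abs (x : E) ≤ 1 → ∃ r ∈ R, abs ((x : E) - r) ≤ abs (π : E) := by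
    refine ⟨Set.range fun β : {β : Wq E abs na F // pmulW E abs na F π hπ1.le β = 0} =>
      π * Quotient.out β.1, Set.finite_range _, fun x hx => ?_⟩
    have hβ : pmulW E abs na F π hπ1.le (mkW E abs na F (x / π)) = 0 := by
      show QuotientAddGroup.mk' (OFadd E abs na F) (π * (x / π)) = 0
      rw [mul_div_cancel₀ _ hπ0, QuotientAddGroup.mk'_apply, QuotientAddGroup.eq_zero_iff]
      exact hx
    refine ⟨_, ⟨⟨_, hβ⟩, rfl⟩, ?_⟩
    have hout : (QuotientAddGroup.mk (Quotient.out (mkW E abs na F (x / π))) :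
        F ⧸ OFadd E abs na F) = QuotientAddGroup.mk (x / π) := Quotient.out_eq _
    have hmem := QuotientAddGroup.eq.1 hout
    set y := Quotient.out (mkW E abs na F (x / π)) with hy
    have hle : abs (((-y + x / π : F)) : E) ≤ 1 := hmem
    have heq : (x : E) - ((π * y : F) : E) = π * ((-y + x / π : F) : E) := by
      push_cast
      field_simp
      ring
    show abs ((x : E) - ((π * y : F) : E)) ≤ _
    rw [heq, map_mul]
    exact mul_le_of_le_one_right hpos.le hle
  obtain ⟨R₁, hR₁, h₁⟩ := hone
  induction N with
  | zero => exact ⟨{0}, Set.finite_singleton _, fun x hx => ⟨0, rfl, by simpa using hx⟩⟩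
  | succ N ih =>
    obtain ⟨R, hR, h⟩ := ih
    refine ⟨Set.image2 (fun r t => r + π ^ N * t) R R₁, hR.image2 _ hR₁, fun x hx => ?_⟩
    obtain ⟨r, hr, hxr⟩ := h x hx
    obtain ⟨t, ht, hxt⟩ := h₁ ((x - r) / π ^ N) (by
      push_cast
      rw [map_div₀, map_pow]
      exact div_le_one_of_le₀ hxr (by positivity))
    refine ⟨_, ⟨r, hr, t, ht, rfl⟩, ?_⟩
    have heq : (x : E) - ((r + π ^ N * t : F) : E) =
        (π : E) ^ N * ((((x - r) / π ^ N : F) : E) - t) := by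
      push_cast
      field_simp
      ring
    rw [heq, map_mul, map_pow, pow_succ]
    gcongr

theorem finite_sigAct_cellRep {na : ∀ x y : E, abs (x + y) ≤ max (abs x) (abs y)}
    {F : Subfield E} {π : F} (hπ0 : π ≠ 0) (hπ1 : abs (π : E) < 1)
    (hfin : Finite {β : Wq E abs na F // pmulW E abs na F π hπ1.le β = 0})
    {χ1 χ2 : Fˣ →* Eˣ} {f : GL (Fin 2) F → E} (hf : IsIndFun E abs F π χ1 χ2 f) (s : Bool) :
    {h | ∃ x : F, abs (x : E) ≤ 1 ∧ h = sigAct E F (cellRep F s x) f}.Finite := by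
  obtain ⟨-, N, hN⟩ := hf
  obtain ⟨R, hR, h⟩ := exists_finite_approx hπ0 hπ1 hfin N
  refine (hR.image fun r => sigAct E F (cellRep F s r) f).subset ?_
  rintro _ ⟨x, hx, rfl⟩
  obtain ⟨r, hr, hxr⟩ := h x hx
  refine ⟨r, hr, funext fun g => ?_⟩
  have hg : g * cellRep F s x = g * cellRep F s r * ((cellRep F s r)⁻¹ * cellRep F s x) := by
    group
  simp only [sigAct]
  rw [hg]
  exact (hN _ _ fun i j => (abs_cellRep_inv_mul_sub_one_le F s r x i j).trans hxr).symm

end Group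

section Rep

variable {E}

/-- The action of `g` on functions with values in polynomials, as a linear map. -/
def rhoLin (F : Subfield E) (m : ℤ) (n : ℕ) (g : GL (Fin 2) F) :
    (GL (Fin 2) F → Polynomial E) →ₗ[E] (GL (Fin 2) F → Polynomial E) where
  toFun := rhoAct E F m n g
  map_add' _ _ := funext fun _ => tauPoly_add _ _ _ _ _
  map_smul' _ _ := funext fun _ => tauPoly_smul _ _ _ _ _

@[simp]
theorem rhoLin_apply (F : Subfield E) (m : ℤ) (n : ℕ) (g : GL (Fin 2) F)
    (Φ : GL (Fin 2) F → Polynomial E) : rhoLin F m n g Φ = rhoAct E F m n g Φ := rfl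

/-- The function `g ↦ f(g)·P` representing `P ⊗ f`. -/
def pureTensor {F : Subfield E} (P : Polynomial E) :
    (GL (Fin 2) F → E) →ₗ[E] (GL (Fin 2) F → Polynomial E) where
  toFun f := fun g => f g • P
  map_add' _ _ := funext fun _ => add_smul _ _ _
  map_smul' _ _ := funext fun _ => mul_smul _ _ _

theorem rhoAct_pureTensor {F : Subfield E} (m : ℤ) (n : ℕ) (g : GL (Fin 2) F)
    (P : Polynomial E) (f : GL (Fin 2) F → E) :
    rhoAct E F m n g (pureTensor P f) =
      pureTensor (tauPoly E m n (matE E F (g : Matrix (Fin 2) (Fin 2) F)) P) (sigAct E F g f) :=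
  funext fun _ => tauPoly_smul _ _ _ _ _

theorem rhoAct_mul {F : Subfield E} (m : ℤ) (n : ℕ) (g h : GL (Fin 2) F)
    {Φ : GL (Fin 2) F → Polynomial E} (hΦ : ∀ x, (Φ x).degree ≤ n) :
    rhoAct E F m n (g * h) Φ = rhoAct E F m n g (rhoAct E F m n h Φ) := by
  funext x
  simp only [rhoAct]
  rw [Units.val_mul, matE_mul, tauPoly_mul m n _ _ (hΦ _), mul_assoc]

theorem rhoAct_one {F : Subfield E} (m : ℤ) (n : ℕ)
    {Φ : GL (Fin 2) F → Polynomial E} (hΦ : ∀ x, (Φ x).degree ≤ n) :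
    rhoAct E F m n 1 Φ = Φ := by
  funext x
  simp only [rhoAct]
  rw [Units.val_one, matE_one, tauPoly_one m n (hΦ _), mul_one]

theorem sum_smul_pureTensor_X_pow {F : Subfield E} {n : ℕ} {P : Polynomial E}
    (hP : P.degree ≤ n) (f : GL (Fin 2) F → E) :
    pureTensor P f =
      ∑ i : Fin (n + 1), P.coeff i • pureTensor ((Polynomial.X : Polynomial E) ^ (i : ℕ)) f := by
  funext g
  simp only [Finset.sum_apply, Pi.smul_apply]
  show f g • P = ∑ i : Fin (n + 1), P.coeff i • f g • (Polynomial.X : Polynomial E) ^ (i : ℕ)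
  conv_lhs => rw [eq_sum_range_smul_X_pow hP, Finset.smul_sum]
  exact Finset.sum_congr rfl fun i _ => smul_comm _ _ _

theorem degree_pureTensor_apply_le {F : Subfield E} {n : ℕ} {P : Polynomial E}
    (hP : P.degree ≤ n) (f : GL (Fin 2) F → E) (g : GL (Fin 2) F) :
    (pureTensor P f g).degree ≤ n :=
  (Polynomial.degree_smul_le _ _).trans hP

theorem degree_X_pow_fin_le {n : ℕ} (i : Fin (n + 1)) :
    ((Polynomial.X : Polynomial E) ^ (i : ℕ)).degree ≤ n :=
  (Polynomial.degree_X_pow_le _).trans (by exact_mod_cast Nat.lt_succ_iff.1 i.2)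

variable {abs : AbsoluteValue E ℝ}

theorem degree_apply_le_of_mem_Vrho {F : Subfield E} {π : F} {χ1 χ2 : Fˣ →* Eˣ} {n : ℕ}
    {Φ : GL (Fin 2) F → Polynomial E} (hΦ : Φ ∈ Vrho E abs F π χ1 χ2 n) (g : GL (Fin 2) F) :
    (Φ g).degree ≤ n := by
  have hle : Vrho E abs F π χ1 χ2 n ≤
      (Polynomial.degreeLE E n).comap (LinearMap.proj g) := by
    refine Submodule.span_le.2 ?_
    rintro _ ⟨P, f, hP, -, rfl⟩
    exact Polynomial.mem_degreeLE.2 (degree_pureTensor_apply_le hP f g)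
  exact Polynomial.mem_degreeLE.1 (hle hΦ)

theorem pureTensor_mem_Vrho {F : Subfield E} {π : F} {χ1 χ2 : Fˣ →* Eˣ} {n : ℕ}
    {P : Polynomial E} (hP : P.degree ≤ n) {f : GL (Fin 2) F → E}
    (hf : IsIndFun E abs F π χ1 χ2 f) : pureTensor P f ∈ Vrho E abs F π χ1 χ2 n :=
  Submodule.subset_span ⟨P, f, hP, hf, rfl⟩

theorem rhoAct_mem_Vrho (na : ∀ x y : E, abs (x + y) ≤ max (abs x) (abs y)) {F : Subfield E}
    {π : F} (hπ0 : π ≠ 0) (hπ1 : abs (π : E) < 1) {χ1 χ2 : Fˣ →* Eˣ} (m : ℤ) {n : ℕ}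
    (g : GL (Fin 2) F) {Φ : GL (Fin 2) F → Polynomial E} (hΦ : Φ ∈ Vrho E abs F π χ1 χ2 n) :
    rhoAct E F m n g Φ ∈ Vrho E abs F π χ1 χ2 n := by
  have hle : Vrho E abs F π χ1 χ2 n ≤ (Vrho E abs F π χ1 χ2 n).comap (rhoLin F m n g) := by
    refine Submodule.span_le.2 ?_
    rintro _ ⟨P, f, hP, hf, rfl⟩
    show rhoAct E F m n g (pureTensor P f) ∈ Vrho E abs F π χ1 χ2 n
    rw [rhoAct_pureTensor]
    exact pureTensor_mem_Vrho (degree_tauPoly_le _ _ _ _) (hf.sigAct na hπ0 hπ1 g)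
  exact hle hΦ

/-- The generators `b(u^i ⊗ v_j)`, `b ∈ B`, of the lattice `Λ`. -/
def borelGens (F : Subfield E) (m : ℤ) (n : ℕ) {r : ℕ} (v : Fin r → (GL (Fin 2) F → E)) :
    Set (GL (Fin 2) F → Polynomial E) :=
  {x | ∃ b : GL (Fin 2) F, (b : Matrix (Fin 2) (Fin 2) F) 1 0 = 0 ∧
    ∃ w ∈ {Φ : GL (Fin 2) F → Polynomial E | ∃ (i : Fin (n + 1)) (j : Fin r),
      Φ = fun g => v j g • (Polynomial.X ^ (i : ℕ) : Polynomial E)}, x = rhoAct E F m n b w}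

theorem rhoAct_mem_borelGens {F : Subfield E} (m : ℤ) {n : ℕ} {r : ℕ}
    (v : Fin r → (GL (Fin 2) F → E)) {b : GL (Fin 2) F}
    (hb : (b : Matrix (Fin 2) (Fin 2) F) 1 0 = 0) (i : Fin (n + 1)) (j : Fin r) :
    rhoAct E F m n b (pureTensor (Polynomial.X ^ (i : ℕ)) (v j)) ∈ borelGens F m n v :=
  ⟨b, hb, _, ⟨i, j, rfl⟩, rfl⟩

theorem Vrho_le_span_borelGens {F : Subfield E} {π : F} {χ1 χ2 : Fˣ →* Eˣ} (m : ℤ) {n : ℕ}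
    {r : ℕ} {v : Fin r → (GL (Fin 2) F → E)}
    (hspan : ∀ f : GL (Fin 2) F → E, IsIndFun E abs F π χ1 χ2 f →
      f ∈ Submodule.span E (OESpan E abs (sigAct E F)
        (fun b => (b : Matrix (Fin 2) (Fin 2) F) 1 0 = 0) (Set.range v))) :
    Vrho E abs F π χ1 χ2 n ≤ Submodule.span E (borelGens F m n v) := by
  refine Submodule.span_le.2 ?_
  rintro _ ⟨P, f, hP, hf, rfl⟩
  have hle : Submodule.span E (OESpan E abs (sigAct E F)
        (fun b => (b : Matrix (Fin 2) (Fin 2) F) 1 0 = 0) (Set.range v)) ≤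
      (Submodule.span E (borelGens F m n v)).comap (pureTensor P) := by
    refine Submodule.span_le.2 ?_
    rintro _ ⟨k, c, b, w, -, hb, hw, rfl⟩
    refine Submodule.sum_mem _ fun t _ => Submodule.smul_mem _ _ ?_
    obtain ⟨j, hj⟩ := hw t
    rw [← hj]
    show pureTensor P (sigAct E F (b t) (v j)) ∈ Submodule.span E (borelGens F m n v)
    set Q := tauPoly E m n (matE E F ((b t)⁻¹ : GL (Fin 2) F)) P with hQ
    have hQdeg : Q.degree ≤ n := degree_tauPoly_le _ _ _ _
    have hPQ : P = tauPoly E m n (matE E F (b t)) Q := by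
      rw [hQ, ← tauPoly_mul m n _ _ hP, ← matE_mul, ← Units.val_mul, mul_inv_cancel,
        Units.val_one, matE_one, tauPoly_one m n hP]
    rw [hPQ, ← rhoAct_pureTensor, sum_smul_pureTensor_X_pow hQdeg, ← rhoLin_apply, map_sum]
    refine Submodule.sum_mem _ fun i _ => ?_
    rw [map_smul]
    exact Submodule.smul_mem _ _ (Submodule.subset_span (rhoAct_mem_borelGens m v (hb t) i j))
  exact hle (hspan f hf)

variable {na : ∀ x y : E, abs (x + y) ≤ max (abs x) (abs y)}

/-- If `e • g` maps each element of `T` into `L`, then it maps the `O_E`-span of `T` into `L`. -/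
theorem rhoAct_smul_mem_of_mem_span {F : Subfield E} (m : ℤ) {n : ℕ} (g : GL (Fin 2) F) (e : E)
    {T : Set (GL (Fin 2) F → Polynomial E)}
    {L : Submodule (integerRing abs na) (GL (Fin 2) F → Polynomial E)}
    (hT : ∀ x ∈ T, e • rhoAct E F m n g x ∈ L) {x : GL (Fin 2) F → Polynomial E}
    (hx : x ∈ Submodule.span (integerRing abs na) T) : e • rhoAct E F m n g x ∈ L := by
  let φ : (GL (Fin 2) F → Polynomial E) →ₗ[integerRing abs na] (GL (Fin 2) F → Polynomial E) :=
    { toFun := fun x => e • rhoLin F m n g x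
      map_add' := fun x y => by simp only [map_add, smul_add]
      map_smul' := fun a x => by
        show e • rhoLin F m n g ((a : E) • x) = (a : E) • e • rhoLin F m n g x
        rw [map_smul, smul_comm] }
  have hle : Submodule.span (integerRing abs na) T ≤ L.comap φ := Submodule.span_le.2 hT
  exact hle hx

theorem rhoAct_mem_span_borelGens {F : Subfield E} (m : ℤ) {n : ℕ} {r : ℕ}
    {v : Fin r → (GL (Fin 2) F → E)} {b : GL (Fin 2) F}
    (hb : (b : Matrix (Fin 2) (Fin 2) F) 1 0 = 0) {x : GL (Fin 2) F → Polynomial E}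
    (hx : x ∈ Submodule.span (integerRing abs na) (borelGens F m n v)) :
    rhoAct E F m n b x ∈ Submodule.span (integerRing abs na) (borelGens F m n v) := by
  have := rhoAct_smul_mem_of_mem_span m (n := n) b 1 (T := borelGens F m n v)
    (L := Submodule.span (integerRing abs na) (borelGens F m n v)) ?_ hx
  · simpa using this
  rintro _ ⟨b', hb', _, ⟨i, j, rfl⟩, rfl⟩
  show (1 : E) • rhoAct E F m n b
    (rhoAct E F m n b' (pureTensor (Polynomial.X ^ (i : ℕ)) (v j))) ∈ _
  rw [one_smul, ← rhoAct_mul m n b b'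
    (degree_pureTensor_apply_le (degree_X_pow_fin_le i) (v j))]
  refine Submodule.subset_span (rhoAct_mem_borelGens m v ?_ i j)
  simp [Matrix.mul_apply, Fin.sum_univ_two, hb, hb']

theorem exists_pow_smul_rhoAct_mem {F : Subfield E} {π : F} (hπ0 : π ≠ 0)
    (hπ1 : abs (π : E) < 1)
    (hfin : Finite {β : Wq E abs na F // pmulW E abs na F π hπ1.le β = 0})
    {χ1 χ2 : Fˣ →* Eˣ} (m : ℤ) {n : ℕ} {r : ℕ} {v : Fin r → (GL (Fin 2) F → E)}
    (hv : ∀ j, IsIndFun E abs F π χ1 χ2 (v j))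
    (hle : Vrho E abs F π χ1 χ2 n ≤ Submodule.span E (borelGens F m n v)) :
    ∃ N : ℕ, ∀ (g : GL (Fin 2) F), ∀ x ∈ Submodule.span (integerRing abs na) (borelGens F m n v),
      (π : E) ^ N • rhoAct E F m n g x ∈
        Submodule.span (integerRing abs na) (borelGens F m n v) := by
  set L := Submodule.span (integerRing abs na) (borelGens F m n v) with hL
  let A : Set (GL (Fin 2) F → Polynomial E) := ⋃ (s : Bool) (j : Fin r) (i : Fin (n + 1)),
    pureTensor (Polynomial.X ^ (i : ℕ)) ''
      {h | ∃ x : F, abs (x : E) ≤ 1 ∧ h = sigAct E F (cellRep F s x) (v j)}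
  have hA : A.Finite := Set.finite_iUnion fun s => Set.finite_iUnion fun j =>
    Set.finite_iUnion fun i => (finite_sigAct_cellRep hπ0 hπ1 hfin (hv j) s).image _
  obtain ⟨N, hN⟩ := exists_pow_smul_mem_of_finite hπ1 L hA (by
    intro y hy
    simp only [A, Set.mem_iUnion] at hy
    obtain ⟨s, j, i, _, ⟨x, -, rfl⟩, rfl⟩ := hy
    exact exists_pow_smul_mem_of_mem_span hπ1 _
      (hle (pureTensor_mem_Vrho (degree_X_pow_fin_le i) ((hv j).sigAct na hπ0 hπ1 _))))
  refine ⟨N, fun g x hx => rhoAct_smul_mem_of_mem_span m g _ ?_ hx⟩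
  rintro _ ⟨b', -, _, ⟨i, j, rfl⟩, rfl⟩
  show (π : E) ^ N • rhoAct E F m n g
    (rhoAct E F m n b' (pureTensor (Polynomial.X ^ (i : ℕ)) (v j))) ∈ L
  rw [← rhoAct_mul m n g b' (degree_pureTensor_apply_le (degree_X_pow_fin_le i) (v j))]
  obtain ⟨b, s, x, hb, hx, hg⟩ := exists_eq_borel_mul_cellRep abs F (g * b')
  rw [hg, rhoAct_mul m n b _ (degree_pureTensor_apply_le (degree_X_pow_fin_le i) (v j)),
    ← rhoLin_apply, ← map_smul, rhoLin_apply]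
  refine rhoAct_mem_span_borelGens m hb ?_
  show (π : E) ^ N • rhoAct E F m n (cellRep F s x) (pureTensor (Polynomial.X ^ (i : ℕ)) (v j)) ∈ L
  rw [rhoAct_pureTensor, sum_smul_pureTensor_X_pow (degree_tauPoly_le m n _ _), Finset.smul_sum]
  refine Submodule.sum_mem _ fun t _ => ?_
  rw [smul_comm]
  refine smul_mem_of_abs_le_one L (abs_coeff_tauPoly_X_pow_le na m (Nat.lt_succ_iff.1 i.2)
    (abs_cellRep_apply_le s hx) (abs_det_cellRep F s x) _) (hN _ ?_)
  simp only [A, Set.mem_iUnion]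
  exact ⟨s, j, t, _, ⟨x, hx, rfl⟩, rfl⟩

end Rep

/-- Proposition 2.3 of the paper: if `O_E[B]v₁ + ⋯ + O_E[B]v_r` spans `V_σ`
over `E` and `ρ = τ⊗σ` is irreducible, then
`Λ = Σ_{i=0}^{n} Σ_{j=1}^{r} O_E[B](u^i ⊗ v_j)` is commensurable with every nonzero cyclic
`O_E[G]`-submodule of `V_ρ = V_τ ⊗ V_σ`. -/
theorem stmt11 [CharZero E] [IsAlgClosed E]
    (abs : AbsoluteValue E ℝ)
    (na : ∀ x y : E, abs (x + y) ≤ max (abs x) (abs y))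
    (F : Subfield E) (π : F)
    (hπ0 : π ≠ 0) (hπ1 : abs (π : E) < 1)
    (hdisc : ∀ x : F, x ≠ 0 → ∃ k : ℤ, abs (x : E) = abs (π : E) ^ k)
    -- the residue field of `F` has `q` elements
    (q : ℕ) (hq : 0 < q)
    (hcard : ∀ γ : Wq E abs na F,
      Nat.card {β : Wq E abs na F // pmulW E abs na F π hπ1.le β = γ} = q)
    -- `χ₁, χ₂` are smooth characters of `F^×`:
    (χ1 χ2 : Fˣ →* Eˣ)
    (hsm1 : ∃ N : ℕ, ∀ u : Fˣ, abs (((u : F) : E) - 1) ≤ abs (π : E) ^ N → χ1 u = 1)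
    (hsm2 : ∃ N : ℕ, ∀ u : Fˣ, abs (((u : F) : E) - 1) ≤ abs (π : E) ^ N → χ2 u = 1)
    -- `χ₁/(ωχ₂) ≠ ω^{±1}`: since `ω` is unramified and every element of `F^×` is a unit
    -- times a power of `π`, this reads:
    (hirr1 : χ1 ≠ χ2)
    (hirr2 : ¬ ((∀ u : Fˣ, abs ((u : F) : E) = 1 → χ1 u = χ2 u) ∧
      ((q : E) ^ 2 * (χ1 (Units.mk0 π hπ0) : E) = (χ2 (Units.mk0 π hπ0) : E))))
    (m : ℤ) (n : ℕ)
    -- `ρ = τ⊗σ` is an irreducible `E[G]`-module: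
    (hirred : Vrho E abs F π χ1 χ2 n ≠ ⊥ ∧
      ∀ U : Submodule E (GL (Fin 2) F → Polynomial E), U ≤ Vrho E abs F π χ1 χ2 n →
        (∀ g : GL (Fin 2) F, ∀ x ∈ U, rhoAct E F m n g x ∈ U) →
        U = ⊥ ∨ U = Vrho E abs F π χ1 χ2 n)
    -- `v₁, …, v_r ∈ V_σ` with `Σ_j O_E[B]v_j` spanning `V_σ` over `E`:
    (r : ℕ) (v : Fin r → (GL (Fin 2) F → E))
    (hv : ∀ j, IsIndFun E abs F π χ1 χ2 (v j))
    (hspan : ∀ f : GL (Fin 2) F → E, IsIndFun E abs F π χ1 χ2 f →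
      f ∈ Submodule.span E (OESpan E abs (sigAct E F)
        (fun b => (b : Matrix (Fin 2) (Fin 2) F) 1 0 = 0) (Set.range v))) :
    -- `Λ = Σ_i Σ_j O_E[B](u^i ⊗ v_j)` is commensurable with every nonzero cyclic
    -- `O_E[G]`-submodule of `V_ρ`:
    ∀ w : GL (Fin 2) F → Polynomial E, w ∈ Vrho E abs F π χ1 χ2 n → w ≠ 0 →
      ∃ c c' : E, c ≠ 0 ∧ c' ≠ 0 ∧
        (∀ x ∈ OESpan E abs (rhoAct E F m n) (fun _ => True) {w},
          ∃ y ∈ OESpan E abs (rhoAct E F m n)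
              (fun b => (b : Matrix (Fin 2) (Fin 2) F) 1 0 = 0)
              {Φ | ∃ (i : Fin (n+1)) (j : Fin r),
                Φ = fun g => v j g • (Polynomial.X ^ (i : ℕ) : Polynomial E)},
            x = c • y) ∧
        (∀ y ∈ OESpan E abs (rhoAct E F m n)
              (fun b => (b : Matrix (Fin 2) (Fin 2) F) 1 0 = 0)
              {Φ | ∃ (i : Fin (n+1)) (j : Fin r),
                Φ = fun g => v j g • (Polynomial.X ^ (i : ℕ) : Polynomial E)},
          ∃ x ∈ OESpan E abs (rhoAct E F m n) (fun _ => True) {w}, y = c' • x) := by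
  intro w hw hw0
  have hfin : Finite {β : Wq E abs na F // pmulW E abs na F π hπ1.le β = 0} :=
    Nat.finite_of_card_ne_zero (by rw [hcard]; exact hq.ne')
  have hπE : (π : E) ≠ 0 := by simpa using hπ0
  have hle := Vrho_le_span_borelGens (n := n) m hspan
  have hwdeg := degree_apply_le_of_mem_Vrho hw
  obtain ⟨N, hN⟩ := exists_pow_smul_rhoAct_mem (na := na) hπ0 hπ1 hfin m hv hle
  obtain ⟨M, hM⟩ := exists_pow_smul_mem_of_mem_span (na := na) hπ1 _ (hle hw)
  let T : Set (GL (Fin 2) F → Polynomial E) := {x | ∃ g : GL (Fin 2) F, True ∧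
    ∃ w' ∈ ({w} : Set (GL (Fin 2) F → Polynomial E)), x = rhoAct E F m n g w'}
  let Lw := Submodule.span (integerRing abs na) T
  have hU : Submodule.span E T = Vrho E abs F π χ1 χ2 n := by
    refine (hirred.2 _ (Submodule.span_le.2 ?_) ?_).resolve_left ?_
    · rintro _ ⟨g, -, _, rfl, rfl⟩
      exact rhoAct_mem_Vrho na hπ0 hπ1 m g hw
    · intro g
      suffices h : Submodule.span E T ≤ (Submodule.span E T).comap (rhoLin F m n g) from
        fun x hx => h hx
      refine Submodule.span_le.2 ?_
      rintro _ ⟨h, -, _, rfl, rfl⟩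
      rw [SetLike.mem_coe, Submodule.mem_comap, rhoLin_apply]
      rw [← rhoAct_mul m n g h hwdeg]
      exact Submodule.subset_span ⟨g * h, trivial, _, rfl, rfl⟩
    · intro hbot
      refine hw0 ((Submodule.mem_bot E).1 (hbot ▸ Submodule.subset_span ⟨1, trivial, w, rfl, ?_⟩))
      rw [rhoAct_one m n hwdeg]
  obtain ⟨K, hK⟩ := exists_pow_smul_mem_of_finite (na := na) hπ1 Lw
    (A := Set.range fun p : Fin (n + 1) × Fin r =>
      pureTensor ((Polynomial.X : Polynomial E) ^ (p.1 : ℕ)) (v p.2)) (Set.finite_range _) (by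
    rintro _ ⟨⟨i, j⟩, rfl⟩
    refine exists_pow_smul_mem_of_mem_span (na := na) hπ1 _ ?_
    rw [hU]
    exact pureTensor_mem_Vrho (degree_X_pow_fin_le i) (hv j))
  rw [coe_OESpan (na := na), coe_OESpan (na := na)]
  refine ⟨((π : E) ^ (N + M))⁻¹, ((π : E) ^ K)⁻¹, inv_ne_zero (pow_ne_zero _ hπE),
    inv_ne_zero (pow_ne_zero _ hπE), ?_, ?_⟩
  · intro x hx
    refine ⟨(π : E) ^ (N + M) • x, ?_, by rw [inv_smul_smul₀ (pow_ne_zero _ hπE)]⟩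
    have hle' : Lw ≤ (Submodule.span (integerRing abs na) (borelGens F m n v)).comap
        (DistribSMul.toLinearMap _ _ ((π : E) ^ (N + M))) := by
      refine Submodule.span_le.2 ?_
      rintro _ ⟨g, -, _, rfl, rfl⟩
      have := hN g _ hM
      rwa [← rhoLin_apply, map_smul, smul_smul, ← pow_add] at this
    exact hle' hx
  · intro y hy
    refine ⟨(π : E) ^ K • y, ?_, by rw [inv_smul_smul₀ (pow_ne_zero _ hπE)]⟩
    have hle' : Submodule.span (integerRing abs na) (borelGens F m n v) ≤ Lw.comap
        (DistribSMul.toLinearMap _ _ ((π : E) ^ K)) := by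
      refine Submodule.span_le.2 ?_
      rintro _ ⟨b, -, _, ⟨i, j, rfl⟩, rfl⟩
      have h1 := rhoAct_smul_mem_of_mem_span m (n := n) b 1 (L := Lw) ?_ (hK _ ⟨(i, j), rfl⟩)
      · rw [one_smul, ← rhoLin_apply, map_smul] at h1
        exact h1
      rintro _ ⟨h, -, _, rfl, rfl⟩
      rw [one_smul, ← rhoAct_mul m n b h hwdeg]
      exact Submodule.subset_span ⟨b * h, trivial, _, rfl, rfl⟩
    exact hle' hy

end BS
end
end

section
/- Let V be an E-vector space, λ, μ ∈ E, k₀ ∈ ℤ, and for each k ≥ k₀ let c′_k, c″_k : W → V be finitely supported, with c′_k = c″_k = 0 for all but finitely many k. Define C′_l(β) = Σ_{k=k₀}^{l} λ^{l−k} Σ_{α∈W : π^{l−k}α=β} c′_k(α), C″_l(β) = Σ_{k=k₀}^{l} μ^{l−k} Σ_{α∈W : π^{l−k}α=β} c″_k(α), c_l = c′_l + c″_l, C_l = C′_l + C″_l, with the convention C_{k₀−1} = 0. Then C_{k₀} = c_{k₀}, and for every l ≥ k₀ and γ ∈ W: C_{l+1}(γ) = (λ+μ) Σ_{β : πβ=γ}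 C_l(β) − μλ Σ_{β : πβ=γ} Σ_{α : πα=β} C_{l−1}(α) − Σ_{β : πβ=γ} (λ c″_l(β) + μ c′_l(β)) + c_{l+1}(γ). -/
open scoped Classical

noncomputable section

namespace BS

variable (E : Type) [Field E]

/-- The coefficient `C_l(β) = Σ_{k=k₀}^{l} λ^{l−k} Σ_{α∈W : π^{l−k}α=β} c_k(α)`. -/
def Csum {V : Type} [AddCommGroup V] [Module E V]
    (abs : AbsoluteValue E ℝ)
    (na : ∀ x y : E, abs (x + y) ≤ max (abs x) (abs y))
    (F : Subfield E) (π : F) (hπ : abs (π : E) ≤ 1)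
    (lam : E) (k0 : ℤ) (c : ℤ → Wq E abs na F → V) (l : ℤ) (β : Wq E abs na F) : V :=
  ∑ k ∈ Finset.Icc k0 l, lam ^ (l - k).toNat •
    (∑ᶠ (α : Wq E abs na F) (_ : (⇑(pmulW E abs na F π hπ))^[(l - k).toNat] α = β), c k α)

/-- Summation over the fibres of a map `f` with finite fibres, as a linear operator. -/
def fiberSum {R W V : Type*} [Semiring R] [AddCommMonoid V] [Module R V]
    (f : W → W) (hf : ∀ w, {x | f x = w}.Finite) : (W → V) →ₗ[R] (W → V) where
  toFun g w := ∑ x ∈ (hf w).toFinset, g x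
  map_add' g h := by
    funext w
    simp [Finset.sum_add_distrib]
  map_smul' r g := by
    funext w
    simp [Finset.smul_sum]

section FiberSum

variable {R W V : Type*} [Semiring R] [AddCommMonoid V] [Module R V]

theorem finsum_fiber_eq_fiberSum (R : Type*) [Semiring R] [Module R V]
    (f : W → W) (hf : ∀ w, {x | f x = w}.Finite) (g : W → V) (w : W) :
    ∑ᶠ (x : W) (_ : f x = w), g x = fiberSum (R := R) f hf g w :=
  finsum_mem_eq_finite_toFinset_sum g (hf w)

theorem finite_fiber_comp {f g : W → W} (hf : ∀ w, {x | f x = w}.Finite)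
    (hg : ∀ w, {x | g x = w}.Finite) (w : W) : {x | (f ∘ g) x = w}.Finite :=
  ((hf w).biUnion fun y _ => hg y).subset fun x hx =>
    Set.mem_biUnion (x := g x) hx rfl

theorem finite_fiber_iterate {f : W → W} (hf : ∀ w, {x | f x = w}.Finite) (n : ℕ) :
    ∀ w, {x | f^[n] x = w}.Finite := by
  induction n with
  | zero => simp
  | succ n ih =>
    rw [Function.iterate_succ']
    exact finite_fiber_comp hf ih

theorem fiberSum_comp {f g : W → W} (hf : ∀ w, {x | f x = w}.Finite)
    (hg : ∀ w, {x | g x = w}.Finite) (h : W → V) :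
    fiberSum (R := R) (f ∘ g) (finite_fiber_comp hf hg) h =
      fiberSum (R := R) f hf (fiberSum (R := R) g hg h) := by
  funext w
  simp only [fiberSum, LinearMap.coe_mk, AddHom.coe_mk]
  rw [← Finset.sum_fiberwise_of_maps_to (t := (hf w).toFinset) (g := g) (by simp)]
  refine Finset.sum_congr rfl fun y hy => Finset.sum_congr ?_ fun _ _ => rfl
  ext x
  simp only [Set.Finite.mem_toFinset, Set.mem_ofPred_eq, Finset.mem_filter,
    Function.comp_apply] at hy ⊢
  exact ⟨And.right, fun hx => ⟨hx ▸ hy, hx⟩⟩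

theorem fiberSum_iterate {f : W → W} (hf : ∀ w, {x | f x = w}.Finite) (n : ℕ) (h : W → V) :
    fiberSum (R := R) f^[n] (finite_fiber_iterate hf n) h = (fiberSum (R := R) f hf ^ n) h := by
  induction n with
  | zero =>
    funext w
    simp [fiberSum]
  | succ n ih =>
    rw [pow_succ', Module.End.mul_apply, ← ih, ← fiberSum_comp hf (finite_fiber_iterate hf n)]
    simp only [Function.iterate_succ']

end FiberSum

section Csum

variable {E} {V : Type} [AddCommGroup V] [Module E V] {abs : AbsoluteValue E ℝ}
  {na : ∀ x y : E, abs (x + y) ≤ max (abs x) (abs y)} {F : Subfield E} {π : F}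
  {hπ : abs (π : E) ≤ 1}

theorem Csum_eq_sum_fiberSum (hf : ∀ w, {x | pmulW E abs na F π hπ x = w}.Finite)
    (lam : E) (k0 : ℤ) (c : ℤ → Wq E abs na F → V) (l : ℤ) :
    Csum E abs na F π hπ lam k0 c l = ∑ k ∈ Finset.Icc k0 l, lam ^ (l - k).toNat •
      (fiberSum (R := E) (pmulW E abs na F π hπ) hf ^ (l - k).toNat) (c k) := by
  funext w
  simp only [Csum, Finset.sum_apply, Pi.smul_apply]
  refine Finset.sum_congr rfl fun k _ => ?_
  rw [finsum_fiber_eq_fiberSum E _ (finite_fiber_iterate hf _), fiberSum_iterate]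

theorem Csum_of_lt (lam : E) {k0 l : ℤ} (hl : l < k0) (c : ℤ → Wq E abs na F → V) :
    Csum E abs na F π hπ lam k0 c l = 0 := by
  funext w
  simp [Csum, Finset.Icc_eq_empty_of_lt hl]

theorem Csum_eq_smul_fiberSum_add (hf : ∀ w, {x | pmulW E abs na F π hπ x = w}.Finite)
    (lam : E) {k0 l : ℤ} (hl : k0 ≤ l) (c : ℤ → Wq E abs na F → V) :
    Csum E abs na F π hπ lam k0 c l =
      lam • fiberSum (R := E) (pmulW E abs na F π hπ) hf
        (Csum E abs na F π hπ lam k0 c (l - 1)) + c l := by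
  have hIcc : Finset.Icc k0 l = insert l (Finset.Icc k0 (l - 1)) := by
    ext k
    simp only [Finset.mem_Icc, Finset.mem_insert]
    omega
  rw [Csum_eq_sum_fiberSum hf, Csum_eq_sum_fiberSum hf, hIcc,
    Finset.sum_insert (by simp), map_sum, Finset.smul_sum, add_comm]
  congr 1
  · refine Finset.sum_congr rfl fun k hk => ?_
    have hk' : (l - k).toNat = (l - 1 - k).toNat + 1 := by
      have := (Finset.mem_Icc.mp hk).2
      omega
    rw [hk', pow_succ', pow_succ', Module.End.mul_apply, map_smul, mul_smul]
  · simp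

end Csum

/-- the two-step recursion relation satisfied by `C_l = C′_l + C″_l`
(Lemma 3.1 of the paper). -/
theorem stmt13 {V : Type} [AddCommGroup V] [Module E V]
    (abs : AbsoluteValue E ℝ)
    (na : ∀ x y : E, abs (x + y) ≤ max (abs x) (abs y))
    (F : Subfield E) (π : F)
    (hπ0 : π ≠ 0) (hπ1 : abs (π : E) < 1)
    -- the residue field has `q` elements: every fibre of `π· : W → W` has `q` elements
    (q : ℕ) (hq : 0 < q)
    (hcard : ∀ γ : Wq E abs na F,
      Nat.card {β : Wq E abs na F // pmulW E abs na F π hπ1.le β = γ} = q)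
    (lam mu : E) (k0 : ℤ)
    (c' c'' : ℤ → Wq E abs na F → V)
    -- each `c′_k`, `c″_k` is finitely supported
    (hfin : ∀ k : ℤ, {β | c' k β ≠ 0}.Finite ∧ {β | c'' k β ≠ 0}.Finite)
    -- `c′_k = c″_k = 0` for all but finitely many `k`
    (hfink : {k : ℤ | c' k ≠ 0 ∨ c'' k ≠ 0}.Finite) :
    -- `C_{k₀} = c_{k₀}`:
    (∀ β : Wq E abs na F,
      Csum E abs na F π hπ1.le lam k0 c' k0 β + Csum E abs na F π hπ1.le mu k0 c'' k0 β =
        c' k0 β + c'' k0 β) ∧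
    -- the recursion (with the convention `C_{k₀−1} = 0`, automatic here):
    (∀ l : ℤ, k0 ≤ l → ∀ γ : Wq E abs na F,
      (Csum E abs na F π hπ1.le lam k0 c' (l+1) γ + Csum E abs na F π hπ1.le mu k0 c'' (l+1) γ) =
        (lam + mu) • (∑ᶠ (β : Wq E abs na F) (_ : pmulW E abs na F π hπ1.le β = γ),
            (Csum E abs na F π hπ1.le lam k0 c' l β + Csum E abs na F π hπ1.le mu k0 c'' l β))
        - (mu * lam) • (∑ᶠ (β : Wq E abs na F) (_ : pmulW E abs na F π hπ1.le β = γ),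
            ∑ᶠ (α : Wq E abs na F) (_ : pmulW E abs na F π hπ1.le α = β),
              (Csum E abs na F π hπ1.le lam k0 c' (l-1) α +
                Csum E abs na F π hπ1.le mu k0 c'' (l-1) α))
        - (∑ᶠ (β : Wq E abs na F) (_ : pmulW E abs na F π hπ1.le β = γ),
            (lam • c'' l β + mu • c' l β))
        + (c' (l+1) γ + c'' (l+1) γ)) := by
  have hf : ∀ w, {x | pmulW E abs na F π hπ1.le x = w}.Finite := fun w =>
    Nat.finite_of_card_ne_zero (by rw [Set.coe_ofPred, hcard w]; exact hq.ne')
  have hrec' := fun l hl => Csum_eq_smul_fiberSum_add hf lam (k0 := k0) (l := l) hl c'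
  have hrec'' := fun l hl => Csum_eq_smul_fiberSum_add hf mu (k0 := k0) (l := l) hl c''
  refine ⟨fun β => ?_, fun l hl γ => ?_⟩
  · rw [hrec' k0 le_rfl, hrec'' k0 le_rfl, Csum_of_lt _ (by omega), Csum_of_lt _ (by omega)]
    simp
  · set T := fiberSum (R := E) (V := V) (pmulW E abs na F π hπ1.le) hf
    have hsum : ∀ (g : Wq E abs na F → V) w,
        ∑ᶠ (x : Wq E abs na F) (_ : pmulW E abs na F π hπ1.le x = w), g x = T g w :=
      finsum_fiber_eq_fiberSum E _ hf
    have h' := congrFun (congrArg T (hrec' l hl)) γ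
    have h'' := congrFun (congrArg T (hrec'' l hl)) γ
    have e' := congrFun (hrec' (l + 1) (by omega)) γ
    have e'' := congrFun (hrec'' (l + 1) (by omega)) γ
    rw [add_sub_cancel_right] at e' e''
    simp only [hsum]
    change _ = (lam + mu) • T (Csum E abs na F π hπ1.le lam k0 c' l +
        Csum E abs na F π hπ1.le mu k0 c'' l) γ -
      (mu * lam) • T (T (Csum E abs na F π hπ1.le lam k0 c' (l - 1) +
        Csum E abs na F π hπ1.le mu k0 c'' (l - 1))) γ -
      T (lam • c'' l + mu • c' l) γ + _
    rw [e', e'']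
    simp only [map_add, map_smul, Pi.add_apply, Pi.smul_apply] at h' h'' ⊢
    rw [h', h'']
    module

end BS
end
end

section
/- Let ξ be a nontrivial character of U_F with values in E^×, of conductor ν ≥ 1 (trivial on U_F^ν = 1+π^νO_F and nontrivial on U_F^{ν−1}, where U_F^0 = U_F). Define, for f ∈ 𝒞, E_ξ f(β) = (τ(ξ^{-1})/q^ν) Σ_{u ∈ U_F/U_F^ν} ξ^{-1}(u) f(β − π^{-ν}u), where τ(ξ^{-1}) = Σ_{u ∈ U_F/U_F^ν} ψ(π^{-ν}u)ξ(u) is the Gauss sum. Then: (a) E_ξ E_{ξ^{-1}} = E_{ξ^{-1}} E_ξ, and this operator is the projection of 𝒞 onto 𝒞₀ along 𝒞₁; (b) S E_ξ = 0; and (c) E_ξ E_{ξ^{-1}} E_ξ = E_ξ. -/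
open scoped Classical

noncomputable section

namespace BS

variable (E : Type) [Field E]

/-- The suspension operator `Sf(β) = Σ_{α : πα=β} f(α)` on functions on `W`. -/
def Sop (abs : AbsoluteValue E ℝ)
    (na : ∀ x y : E, abs (x + y) ≤ max (abs x) (abs y))
    (F : Subfield E) (π : F) (hπ : abs (π : E) ≤ 1)
    (f : Wq E abs na F → E) (β : Wq E abs na F) : E :=
  ∑ᶠ (α : Wq E abs na F) (_ : pmulW E abs na F π hπ α = β), f α

/-- `𝒞₀ = {f : Σ_{t∈W₁} f(β+t) = 0 for all β}`; here `W₁ = ker(π· : W → W)`. -/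
def predC0 (abs : AbsoluteValue E ℝ)
    (na : ∀ x y : E, abs (x + y) ≤ max (abs x) (abs y))
    (F : Subfield E) (π : F) (hπ : abs (π : E) ≤ 1)
    (f : Wq E abs na F → E) : Prop :=
  ∀ β : Wq E abs na F,
    (∑ᶠ (t : Wq E abs na F) (_ : pmulW E abs na F π hπ t = 0), f (β + t)) = 0

/-- `𝒞₁ = {f : f(β) depends only on πβ}`. -/
def predC1 (abs : AbsoluteValue E ℝ)
    (na : ∀ x y : E, abs (x + y) ≤ max (abs x) (abs y))
    (F : Subfield E) (π : F) (hπ : abs (π : E) ≤ 1)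
    (f : Wq E abs na F → E) : Prop :=
  ∀ β β' : Wq E abs na F, pmulW E abs na F π hπ β = pmulW E abs na F π hπ β' → f β = f β'

/-- The subset `{δ ∈ W : δ = π^{-ν}u·O_F for a unit u}` of `W`, i.e. the classes of the
elements of absolute value `|π|^{-ν}`; it is in natural bijection with `U_F/U_F^ν`. -/
def Dnu (abs : AbsoluteValue E ℝ)
    (na : ∀ x y : E, abs (x + y) ≤ max (abs x) (abs y))
    (F : Subfield E) (π : F) (ν : ℕ) : Set (Wq E abs na F) :=
  {δ | ∃ b : F, mkW E abs na F b = δ ∧ abs (b : E) = abs (π : E) ^ (-(ν : ℤ))}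

/-- The Gauss sum `τ(ξ⁻¹) = Σ_{u ∈ U_F/U_F^ν} ψ(π^{-ν}u)ξ(u)`, written as a sum over the
classes `δ = π^{-ν}u·O_F ∈ W` (the summand depends only on the class of `u` in `U_F/U_F^ν`,
i.e. only on `δ`, so any lift — here `Quotient.out δ` — may be used). -/
def gauss (abs : AbsoluteValue E ℝ)
    (na : ∀ x y : E, abs (x + y) ≤ max (abs x) (abs y))
    (F : Subfield E) (π : F) (ψ ξ : F → E) (ν : ℕ) : E :=
  ∑ᶠ (δ : Wq E abs na F) (_ : δ ∈ Dnu E abs na F π ν),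
    ψ (Quotient.out δ) * ξ (π ^ ν * Quotient.out δ)

/-- The convolution operator
`E_ξ f(β) = (τ(ξ⁻¹)/q^ν) Σ_{u ∈ U_F/U_F^ν} ξ⁻¹(u) f(β − π^{-ν}u)`, written as a sum over
the classes `δ = π^{-ν}u·O_F ∈ W` (with `u = π^ν·(any lift of δ)`). -/
def Eop (abs : AbsoluteValue E ℝ)
    (na : ∀ x y : E, abs (x + y) ≤ max (abs x) (abs y))
    (F : Subfield E) (π : F) (ψ ξ : F → E) (ν q : ℕ)
    (f : Wq E abs na F → E) (β : Wq E abs na F) : E :=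
  (gauss E abs na F π ψ ξ ν / (q : E) ^ ν) *
    ∑ᶠ (δ : Wq E abs na F) (_ : δ ∈ Dnu E abs na F π ν),
      (ξ (π ^ ν * Quotient.out δ))⁻¹ * f (β - δ)

section Convolution

variable {W K : Type*} [AddCommGroup W] [Field K]

/-- A function `h` supported on a finite set `D`, modelled on a primitive character of conductor
`ν` viewed on `π^{-ν}U_F/O_F`; here `T = W₁` and `V = π^{-ν}O_F/O_F`. -/
structure IsPrimitiveOn (T V : AddSubgroup W) (D : Finset W) (h : W → K) (ε : K) : Prop where
  ne_zero_iff : ∀ δ, h δ ≠ 0 ↔ δ ∈ D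
  subset : ∀ δ ∈ D, δ ∈ V
  le : T ≤ V
  map_neg : ∀ δ, h (-δ) = ε * h δ
  exists_add : ∀ γ ∉ T, ∀ t ∈ T, ∃ (e : W ≃+ W) (c : K), c ≠ 0 ∧
    (∀ δ, h (e δ) = c * h δ) ∧ e γ = γ + t
  exists_of_mem : ∀ γ ∈ T, γ ≠ 0 → ∀ t ∈ T, t ≠ 0 → ∃ (e : W ≃+ W) (c : K), c ≠ 0 ∧
    (∀ δ, h (e δ) = c * h δ) ∧ e γ = t
  exists_ne_one : ∃ (e : W ≃+ W) (c : K), c ≠ 0 ∧ c ≠ 1 ∧ (∀ δ, h (e δ) = c * h δ) ∧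
    (∀ t, e t ∈ T ↔ t ∈ T) ∧ ∀ δ ∈ V, e δ - δ ∈ T

/-- The operator `f ↦ (τ/q^ν) Σ_{δ ∈ D} h(δ)⁻¹ f(· - δ)` with `τ = Σ_{δ ∈ D} Ψ(δ) h(δ)`. -/
def convOp (D : Finset W) (Ψ h : W → K) (n : K) (f : W → K) (β : W) : K :=
  (∑ δ ∈ D, Ψ δ * h δ) / n * ∑ δ ∈ D, (h δ)⁻¹ * f (β - δ)

namespace IsPrimitiveOn

variable {T V : AddSubgroup W} {D : Finset W} {h : W → K} {ε : K}

theorem eq_zero (H : IsPrimitiveOn T V D h ε) {δ : W} (hδ : δ ∉ D) : h δ = 0 := by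
  by_contra h0
  exact hδ ((H.ne_zero_iff δ).1 h0)

theorem inv (H : IsPrimitiveOn T V D h ε) : IsPrimitiveOn T V D h⁻¹ ε⁻¹ where
  ne_zero_iff δ := by simpa using H.ne_zero_iff δ
  subset := H.subset
  le := H.le
  map_neg δ := by simp [H.map_neg, mul_comm]
  exists_add γ hγ t ht := by
    obtain ⟨e, c, hc, he, h1⟩ := H.exists_add γ hγ t ht
    exact ⟨e, c⁻¹, inv_ne_zero hc, fun δ => by simp [he, mul_comm], h1⟩
  exists_of_mem γ hγ hγ0 t ht ht0 := by
    obtain ⟨e, c, hc, he, h1⟩ := H.exists_of_mem γ hγ hγ0 t ht ht0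
    exact ⟨e, c⁻¹, inv_ne_zero hc, fun δ => by simp [he, mul_comm], h1⟩
  exists_ne_one := by
    obtain ⟨e, c, hc, hc1, he, h1⟩ := H.exists_ne_one
    exact ⟨e, c⁻¹, inv_ne_zero hc, by simpa using hc1, fun δ => by simp [he, mul_comm], h1⟩

theorem eps_mul_self (H : IsPrimitiveOn T V D h ε) (hD : D.Nonempty) : ε * ε = 1 := by
  obtain ⟨δ, hδ⟩ := hD
  have h0 := (H.ne_zero_iff δ).2 hδ
  have h1 := H.map_neg (-δ)
  rw [neg_neg, H.map_neg, ← mul_assoc] at h1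
  exact mul_right_cancel₀ h0 (by rw [one_mul]; exact h1.symm)

theorem sum_eq (H : IsPrimitiveOn T V D h ε) [Fintype V] {F : W → K} (hF : ∀ δ ∉ D, F δ = 0) :
    ∑ δ ∈ D, F δ = ∑ γ : V, F γ := by
  symm
  rw [← Finset.sum_subset (Finset.subset_univ (Finset.univ.filter fun γ : V => (γ : W) ∈ D))]
  · refine Finset.sum_bij (fun γ _ => (γ : W)) (fun γ hγ => by simpa using hγ) ?_ ?_ ?_
    · intro a _ b _ hab
      exact Subtype.ext hab
    · intro b hb
      exact ⟨⟨b, H.subset _ hb⟩, by simpa using hb, rfl⟩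
    · intro a _
      rfl
  · intro γ _ hγ
    exact hF _ (by simpa using hγ)

theorem sum_add_eq_zero (H : IsPrimitiveOn T V D h ε) [Fintype T] (δ : W) :
    ∑ t : T, h (δ + t) = 0 := by
  by_cases hδ : δ ∈ V
  · obtain ⟨e, c, -, hc1, he, heT, heV⟩ := H.exists_ne_one
    have key : ∑ t : T, h (δ + t) = ∑ t : T, h (e (δ + t)) := by
      refine (Finset.sum_bij (fun (t : T) _ => (⟨e t + (e δ - δ),
        T.add_mem ((heT t).2 t.2) (heV δ hδ)⟩ : T)) (fun _ _ => Finset.mem_univ _) ?_ ?_ ?_).symm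
      · intro a _ b _ hab
        simpa using hab
      · intro b _
        refine ⟨⟨e.symm (b - (e δ - δ)), ?_⟩, Finset.mem_univ _, ?_⟩
        · rw [← heT, e.apply_symm_apply]
          exact T.sub_mem b.2 (heV δ hδ)
        · simp
      · intro a _
        congr 1
        simp only [map_add]
        abel
    simp only [he, ← Finset.mul_sum] at key
    by_contra h0
    exact hc1 (mul_right_cancel₀ h0 (by rw [one_mul]; exact key.symm))
  · refine Finset.sum_eq_zero fun t _ => H.eq_zero fun hD => hδ ?_
    simpa using V.sub_mem (H.subset _ hD) (H.le t.2)

theorem sum_conv_apply_equiv (H : IsPrimitiveOn T V D h ε) (e : W ≃+ W) {c : K} (hc : c ≠ 0)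
    (he : ∀ δ, h (e δ) = c * h δ) (γ : W) :
    ∑ δ ∈ D, (h δ)⁻¹ * h (e γ - δ) = ∑ δ ∈ D, (h δ)⁻¹ * h (γ - δ) := by
  symm
  refine Finset.sum_equiv e.toEquiv (fun δ => ?_) fun δ _ => ?_
  · simp [← H.ne_zero_iff, he, hc]
  · have : h (e γ - e δ) = c * h (γ - δ) := by rw [← map_sub, he]
    simp only [AddEquiv.toEquiv_eq_coe, EquivLike.coe_coe, this, he]
    field_simp

theorem sum_conv_add_eq_zero (H : IsPrimitiveOn T V D h ε) [Fintype T] (γ : W) :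
    ∑ t : T, ∑ δ ∈ D, (h δ)⁻¹ * h (γ + t - δ) = 0 := by
  rw [Finset.sum_comm]
  refine Finset.sum_eq_zero fun δ _ => ?_
  rw [← Finset.mul_sum]
  simp only [add_sub_right_comm, H.sum_add_eq_zero, mul_zero]

theorem conv_eq [CharZero K] (H : IsPrimitiveOn T V D h ε) [Fintype T] {q ν : ℕ} (hν : 1 ≤ ν)
    (hT : Fintype.card T = q) (hD : D.card + q ^ (ν - 1) = q ^ ν) (γ : W) :
    ∑ δ ∈ D, (h δ)⁻¹ * h (γ - δ) =
      ε * q ^ ν * ((if γ = 0 then 1 else 0) - (q : K)⁻¹ * if γ ∈ T then 1 else 0) := by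
  have hq : (q : K) ≠ 0 := by
    rw [← hT]; exact_mod_cast Fintype.card_ne_zero
  have hqν : (q : K) ^ ν = q ^ (ν - 1) * q := by
    rw [← pow_succ, Nat.sub_add_cancel hν]
  have hD' : (D.card : K) = q ^ ν - q ^ (ν - 1) := by
    rw [eq_sub_iff_add_eq]; exact_mod_cast hD
  have h0 : ∑ δ ∈ D, (h δ)⁻¹ * h (0 - δ) = ε * (q ^ ν - q ^ (ν - 1)) := by
    rw [← hD', mul_comm, ← nsmul_eq_mul, ← Finset.sum_const]
    refine Finset.sum_congr rfl fun δ hδ => ?_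
    have := (H.ne_zero_iff δ).2 hδ
    rw [zero_sub, H.map_neg]
    field_simp
  by_cases hγ0 : γ = 0
  · subst hγ0
    rw [h0, if_pos rfl, if_pos T.zero_mem, hqν]
    field_simp
  by_cases hγ : γ ∈ T
  · have hs := H.sum_conv_add_eq_zero 0
    rw [Fintype.sum_eq_add_sum_compl (0 : T), Finset.sum_congr (s₁ := {0}ᶜ) rfl
      (g := fun _ => ∑ δ ∈ D, (h δ)⁻¹ * h (γ - δ))] at hs
    · rw [Finset.sum_const, Finset.card_compl, hT, Finset.card_singleton, nsmul_eq_mul] at hs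
      simp only [AddSubgroup.coe_zero, add_zero, h0] at hs
      have hq1 : 1 < q := by
        rw [← hT, Fintype.one_lt_card_iff]
        exact ⟨⟨γ, hγ⟩, 0, fun h => hγ0 (congrArg Subtype.val h)⟩
      have hq1' : (q : K) - 1 ≠ 0 := by
        rw [sub_ne_zero]; exact_mod_cast hq1.ne'
      rw [Nat.cast_sub hq1.le, Nat.cast_one] at hs
      rw [if_neg hγ0, if_pos hγ]
      apply mul_left_cancel₀ hq1'
      rw [eq_neg_of_add_eq_zero_right hs, hqν]
      field_simp
      ring
    · intro t ht
      have ht0 : (t : W) ≠ 0 := by simpa using ht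
      obtain ⟨e, c, hc, he, h1⟩ := H.exists_of_mem γ hγ hγ0 t t.2 ht0
      rw [zero_add, ← h1, H.sum_conv_apply_equiv e hc he]
  · have hs := H.sum_conv_add_eq_zero γ
    rw [Finset.sum_congr rfl (g := fun _ => ∑ δ ∈ D, (h δ)⁻¹ * h (γ - δ))] at hs
    · rw [Finset.sum_const, Finset.card_univ, hT, nsmul_eq_mul] at hs
      rw [if_neg hγ0, if_neg hγ, (mul_eq_zero.1 hs).resolve_left hq]
      simp
    · intro t _
      obtain ⟨e, c, hc, he, h1⟩ := H.exists_add γ hγ t t.2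
      rw [← h1, H.sum_conv_apply_equiv e hc he]

theorem sum_sum_eq [CharZero K] (H : IsPrimitiveOn T V D h ε) [Fintype T] [Fintype V] {q ν : ℕ}
    (hν : 1 ≤ ν) (hT : Fintype.card T = q) (hD : D.card + q ^ (ν - 1) = q ^ ν) (g : W → K) :
    ∑ δ ∈ D, ∑ δ' ∈ D, (h δ)⁻¹ * h δ' * g (δ + δ') =
      ε * q ^ ν * (g 0 - (q : K)⁻¹ * ∑ t : T, g t) := by
  have step : ∀ δ ∈ D, ∑ δ' ∈ D, (h δ)⁻¹ * h δ' * g (δ + δ') =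
      ∑ γ : V, (h δ)⁻¹ * h (γ - δ) * g γ := by
    intro δ hδ
    rw [H.sum_eq fun δ' hδ' => by simp [H.eq_zero hδ'],
      ← Equiv.sum_comp (Equiv.subRight (⟨δ, H.subset δ hδ⟩ : V))]
    simp
  rw [Finset.sum_congr rfl step, Finset.sum_comm]
  simp only [← Finset.sum_mul, H.conv_eq hν hT hD]
  simp only [mul_assoc, ← Finset.mul_sum, sub_mul, Finset.sum_sub_distrib]
  congr 3
  · rw [Finset.sum_eq_single (0 : V)] <;> simp +contextual
  · congr 1
    rw [← Finset.sum_subset (Finset.subset_univ (Finset.univ.filter fun γ : V => (γ : W) ∈ T))]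
    · refine Finset.sum_bij (fun γ hγ => (⟨γ, by simpa using hγ⟩ : T)) (by simp) ?_ ?_ ?_
      · intro a _ b _ hab
        exact Subtype.ext (Subtype.mk.inj hab)
      · intro b _
        exact ⟨⟨b, H.le b.2⟩, by simp, rfl⟩
      · intro a ha
        simp only [Finset.mem_filter, Finset.mem_univ, true_and] at ha
        simp [ha]
    · intro γ _ hγ
      simp only [Finset.mem_filter, Finset.mem_univ, true_and] at hγ
      simp [hγ]

theorem sum_convOp_eq_zero (H : IsPrimitiveOn T V D h ε) [Fintype T] [Fintype V] (Ψ : W → K) (n : K)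
    (f : W → K) (β : W) : ∑ t : T, convOp D Ψ h n f (β + t) = 0 := by
  have key (t : T) : ∑ δ ∈ D, (h δ)⁻¹ * f (β + t - δ) =
      ∑ γ : V, (h (γ + t))⁻¹ * f (β - γ) := by
    rw [H.sum_eq fun δ hδ => by simp [H.eq_zero hδ],
      ← Equiv.sum_comp (Equiv.addRight (⟨t, H.le t.2⟩ : V))]
    simp [add_sub_add_right_eq_sub]
  simp only [convOp, ← Finset.mul_sum, key]
  rw [Finset.sum_comm]
  simp only [← Finset.sum_mul]
  refine mul_eq_zero_of_right _ (Finset.sum_eq_zero fun γ _ => ?_)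
  have := H.inv.sum_add_eq_zero (γ : W)
  simp only [Pi.inv_apply] at this
  rw [this, zero_mul]

theorem convOp_convOp_inv [CharZero K] (H : IsPrimitiveOn T V D h ε) [Fintype T] [Fintype V]
    {q ν : ℕ} (hν : 1 ≤ ν) (hT : Fintype.card T = q) (hD : D.card + q ^ (ν - 1) = q ^ ν)
    (hDn : D.Nonempty) {Ψ : W → K} (hΨ0 : Ψ 0 = 1) (hΨ : ∀ x y, Ψ (x + y) = Ψ x * Ψ y)
    (hΨT : ∃ t ∈ T, Ψ t ≠ 1) (f : W → K) (β : W) :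
    convOp D Ψ h (q ^ ν) (convOp D Ψ h⁻¹ (q ^ ν) f) β =
      f β - (q : K)⁻¹ * ∑ t : T, f (β - t) := by
  have hq : (q : K) ≠ 0 := by
    rw [← hT]; exact_mod_cast Fintype.card_ne_zero
  have hsum : ∑ t : T, Ψ t = 0 := by
    obtain ⟨s, hs, hs1⟩ := hΨT
    have : ∑ t : T, Ψ t = Ψ s * ∑ t : T, Ψ t := by
      rw [Finset.mul_sum, ← Equiv.sum_comp (Equiv.addLeft (⟨s, hs⟩ : T))]
      simp [hΨ]
    by_contra h0
    exact hs1 (mul_right_cancel₀ h0 (by rw [one_mul]; exact this.symm))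
  have hg : (∑ δ ∈ D, Ψ δ * h δ) * (∑ δ ∈ D, Ψ δ * h⁻¹ δ) = ε * q ^ ν := by
    have := H.sum_sum_eq hν hT hD Ψ
    rw [hsum, hΨ0, mul_zero, sub_zero, mul_one] at this
    rw [← this, mul_comm, Finset.sum_mul_sum]
    refine Finset.sum_congr rfl fun δ _ => Finset.sum_congr rfl fun δ' _ => ?_
    rw [hΨ, Pi.inv_apply]
    ring
  have hf := H.sum_sum_eq hν hT hD fun γ => f (β - γ)
  simp only [sub_zero] at hf
  have hε := H.eps_mul_self hDn
  have expand : convOp D Ψ h (q ^ ν) (convOp D Ψ h⁻¹ (q ^ ν) f) β =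
      (∑ δ ∈ D, Ψ δ * h δ) * (∑ δ ∈ D, Ψ δ * h⁻¹ δ) / (q ^ ν * q ^ ν) *
        ∑ δ ∈ D, ∑ δ' ∈ D, (h δ)⁻¹ * h δ' * f (β - (δ + δ')) := by
    unfold convOp
    generalize ∑ δ ∈ D, Ψ δ * h δ = A
    generalize ∑ δ ∈ D, Ψ δ * h⁻¹ δ = B
    simp only [Finset.mul_sum, Pi.inv_apply, inv_inv, sub_sub]
    refine Finset.sum_congr rfl fun δ _ => Finset.sum_congr rfl fun δ' _ => ?_
    ring
  rw [expand, hg, hf]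
  have : ε * (q : K) ^ ν / (q ^ ν * q ^ ν) * (ε * q ^ ν * (f β - (q : K)⁻¹ * ∑ t : T, f (β - t))) =
      (ε * ε) * (f β - (q : K)⁻¹ * ∑ t : T, f (β - t)) := by
    field_simp
  rw [this, hε, one_mul]

end IsPrimitiveOn

end Convolution

theorem card_preimage_of_card_fiber {A B : Type*} (φ : A → B) {q : ℕ} (hq : 0 < q)
    (hφ : ∀ b, Nat.card {a // φ a = b} = q) (s : Set B) :
    Nat.card (φ ⁻¹' s) = Nat.card s * q := by
  have e (b : B) : {a // φ a = b} ≃ Fin q := Nat.equivFinOfCardPos (by rw [hφ]; exact hq.ne') |>.trans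
    (finCongr (hφ b))
  have e' : (φ ⁻¹' s) ≃ s × Fin q :=
    { toFun a := (⟨φ a, a.2⟩, e (φ a) ⟨a, rfl⟩)
      invFun b := ⟨((e b.1).symm b.2).1, by
        rw [Set.mem_preimage, ((e b.1).symm b.2).2]; exact b.1.2⟩
      left_inv a := by simp
      right_inv := by
        rintro ⟨⟨b, hb⟩, i⟩
        have hi := (e b).apply_symm_apply i
        dsimp only
        generalize (e b).symm i = x at hi
        obtain ⟨a, rfl⟩ := x
        rw [hi] }
  rw [Nat.card_congr e', Nat.card_prod, Nat.card_fin]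

section LocalField

variable {E} {abs : AbsoluteValue E ℝ} {na : ∀ x y : E, abs (x + y) ≤ max (abs x) (abs y)}
  {F : Subfield E} {π : F}

theorem abs_add_eq_left (na : ∀ x y : E, abs (x + y) ≤ max (abs x) (abs y)) {x y : E}
    (hxy : abs y < abs x) : abs (x + y) = abs x := by
  apply le_antisymm
  · exact (na x y).trans (max_le le_rfl hxy.le)
  · have := na (x + y) (-y)
    rw [add_neg_cancel_right, abs.map_neg] at this
    exact (le_max_iff.1 this).resolve_right hxy.not_ge

theorem mkW_eq_zero (b : F) : mkW E abs na F b = 0 ↔ abs (b : E) ≤ 1 :=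
  QuotientAddGroup.eq_zero_iff b

theorem mkW_surjective : Function.Surjective (mkW E abs na F) :=
  QuotientAddGroup.mk'_surjective _

theorem mkW_out (δ : Wq E abs na F) : mkW E abs na F (Quotient.out δ) = δ :=
  Quotient.out_eq δ

theorem exists_out_mkW (b : F) :
    ∃ o : F, abs (o : E) ≤ 1 ∧ Quotient.out (mkW E abs na F b) = b + o := by
  refine ⟨Quotient.out (mkW E abs na F b) - b, ?_, by abel⟩
  rw [← mkW_eq_zero (na := na), map_sub, mkW_out, sub_self]

@[simp]
theorem pmulW_mkW (u : F) (hu : abs (u : E) ≤ 1) (b : F) :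
    pmulW E abs na F u hu (mkW E abs na F b) = mkW E abs na F (u * b) :=
  rfl

/-- Multiplication by a unit as an automorphism of `W`. -/
def unitEquiv (na : ∀ x y : E, abs (x + y) ≤ max (abs x) (abs y)) (u : F)
    (hu : abs (u : E) = 1) : Wq E abs na F ≃+ Wq E abs na F :=
  have hu0 : u ≠ 0 := by rintro rfl; simp at hu
  { pmulW E abs na F u hu.le with
    invFun := pmulW E abs na F u⁻¹ (by simp [map_inv₀, hu])
    left_inv := fun δ => by
      obtain ⟨b, rfl⟩ := mkW_surjective δ
      simp [hu0]
    right_inv := fun δ => by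
      obtain ⟨b, rfl⟩ := mkW_surjective δ
      simp [hu0] }

@[simp]
theorem unitEquiv_mkW (u : F) (hu : abs (u : E) = 1) (b : F) :
    unitEquiv na u hu (mkW E abs na F b) = mkW E abs na F (u * b) :=
  rfl

/-- The subgroup `π^{-n}O_F/O_F` of `W`. -/
def torsionW (na : ∀ x y : E, abs (x + y) ≤ max (abs x) (abs y)) (hπ : abs (π : E) ≤ 1) (n : ℕ) :
    AddSubgroup (Wq E abs na F) :=
  (pmulW E abs na F (π ^ n) (by simpa using pow_le_one₀ (abs.nonneg _) hπ)).ker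

theorem mkW_mem_torsionW (hπ : abs (π : E) ≤ 1) (n : ℕ) (b : F) :
    mkW E abs na F b ∈ torsionW na hπ n ↔ abs (π : E) ^ n * abs (b : E) ≤ 1 := by
  rw [torsionW, AddMonoidHom.mem_ker, pmulW_mkW, mkW_eq_zero]
  simp

theorem mem_torsionW_one (hπ : abs (π : E) ≤ 1) (δ : Wq E abs na F) :
    δ ∈ torsionW na hπ 1 ↔ pmulW E abs na F π hπ δ = 0 := by
  obtain ⟨b, rfl⟩ := mkW_surjective δ
  rw [mkW_mem_torsionW, pmulW_mkW, mkW_eq_zero]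
  simp

theorem card_torsionW (hπ : abs (π : E) ≤ 1) {q : ℕ} (hq : 0 < q)
    (hcard : ∀ γ : Wq E abs na F, Nat.card {β : Wq E abs na F // pmulW E abs na F π hπ β = γ} = q)
    (n : ℕ) : Nat.card (torsionW na hπ n) = q ^ n := by
  induction n with
  | zero =>
    rw [pow_zero, Nat.card_eq_one_iff_unique]
    refine ⟨⟨?_⟩, ⟨0⟩⟩
    suffices h : ∀ a : torsionW na hπ 0, a = 0 from fun a b => (h a).trans (h b).symm
    rintro ⟨a, ha⟩
    obtain ⟨b, rfl⟩ := mkW_surjective a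
    rw [mkW_mem_torsionW, pow_zero, one_mul] at ha
    exact Subtype.ext ((mkW_eq_zero b).2 ha)
  | succ n ih =>
    rw [pow_succ, ← ih]
    refine Eq.trans (Nat.card_congr (Equiv.setCongr ?_))
      (card_preimage_of_card_fiber _ hq hcard (torsionW na hπ n : Set (Wq E abs na F)))
    ext a
    obtain ⟨b, rfl⟩ := mkW_surjective a
    simp only [SetLike.mem_coe, Set.mem_preimage, pmulW_mkW, mkW_mem_torsionW]
    simp [pow_succ, mul_assoc]

theorem mkW_mem_Dnu (hπ0 : π ≠ 0) (hπ1 : abs (π : E) < 1) {ν : ℕ} (hν : 1 ≤ ν) (b : F) :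
    mkW E abs na F b ∈ Dnu E abs na F π ν ↔ abs (π : E) ^ ν * abs (b : E) = 1 := by
  have hp : 0 < abs (π : E) := abs.pos (by simpa using hπ0)
  have key (c : F) : abs (c : E) = abs (π : E) ^ (-(ν : ℤ)) ↔ abs (π : E) ^ ν * abs (c : E) = 1 := by
    rw [zpow_neg, zpow_natCast, ← mul_eq_one_iff_eq_inv₀ (pow_pos hp _).ne', mul_comm]
  constructor
  · rintro ⟨c, hc, hc1⟩
    rw [key] at hc1
    have hbc : abs ((b - c : F) : E) ≤ 1 := by
      rw [← mkW_eq_zero (na := na), map_sub, hc, sub_self]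
    have hc2 : 1 < abs (c : E) := by
      by_contra! h
      have := mul_lt_one_of_nonneg_of_lt_one_left (pow_nonneg hp.le ν)
        (pow_lt_one₀ hp.le hπ1 (by omega)) h
      linarith
    have := abs_add_eq_left na (hbc.trans_lt hc2)
    rw [show (c : E) + ((b - c : F) : E) = b by push_cast; ring] at this
    rw [this, hc1]
  · intro h
    exact ⟨b, rfl, (key b).2 h⟩

theorem Dnu_subset_torsionW (hπ0 : π ≠ 0) (hπ1 : abs (π : E) < 1) {ν : ℕ} (hν : 1 ≤ ν) :
    Dnu E abs na F π ν ⊆ torsionW na hπ1.le ν := by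
  intro δ hδ
  obtain ⟨b, rfl⟩ := mkW_surjective δ
  rw [mkW_mem_Dnu hπ0 hπ1 hν] at hδ
  exact (mkW_mem_torsionW hπ1.le ν b).2 hδ.le

/-- There is no absolute value strictly between `|π|` and `1`. -/
theorem abs_eq_one_of_lt (hπ0 : π ≠ 0) (hπ1 : abs (π : E) < 1)
    (hdisc : ∀ x : F, x ≠ 0 → ∃ k : ℤ, abs (x : E) = abs (π : E) ^ k) {x : F}
    (hx : abs (x : E) ≤ 1) (hx' : abs (π : E) < abs (x : E)) : abs (x : E) = 1 := by
  have hp : 0 < abs (π : E) := abs.pos (by simpa using hπ0)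
  have hx0 : x ≠ 0 := by
    rintro rfl
    simp at hx'
    exact absurd hx' hp.not_gt
  obtain ⟨k, hk⟩ := hdisc x hx0
  rw [hk] at hx hx' ⊢
  have h1 : 0 ≤ k := by
    rwa [← zpow_zero (abs (π : E)), zpow_le_zpow_iff_right_of_lt_one₀ hp hπ1] at hx
  have h2 : k < 1 := by
    nth_rewrite 1 [← zpow_one (abs (π : E))] at hx'
    rwa [zpow_lt_zpow_iff_right_of_lt_one₀ hp hπ1] at hx'
  rw [show k = 0 by omega, zpow_zero]

theorem ncard_Dnu_add (hπ0 : π ≠ 0) (hπ1 : abs (π : E) < 1)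
    (hdisc : ∀ x : F, x ≠ 0 → ∃ k : ℤ, abs (x : E) = abs (π : E) ^ k) {q : ℕ} (hq : 0 < q)
    (hcard : ∀ γ : Wq E abs na F,
      Nat.card {β : Wq E abs na F // pmulW E abs na F π hπ1.le β = γ} = q)
    {ν : ℕ} (hν : 1 ≤ ν) : (Dnu E abs na F π ν).ncard + q ^ (ν - 1) = q ^ ν := by
  have hp : 0 < abs (π : E) := abs.pos (by simpa using hπ0)
  obtain ⟨n, rfl⟩ : ∃ n, ν = n + 1 := ⟨ν - 1, by omega⟩
  have hfin (m : ℕ) : (torsionW na hπ1.le m : Set (Wq E abs na F)).Finite :=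
    Nat.finite_of_card_ne_zero (by
      change Nat.card (torsionW na hπ1.le m) ≠ 0
      rw [card_torsionW hπ1.le hq hcard]
      exact (pow_pos hq _).ne')
  rw [Nat.add_sub_cancel, ← card_torsionW hπ1.le hq hcard n,
    ← card_torsionW hπ1.le hq hcard (n + 1)]
  change _ + (torsionW na hπ1.le n : Set (Wq E abs na F)).ncard =
    (torsionW na hπ1.le (n + 1) : Set (Wq E abs na F)).ncard
  rw [← Set.ncard_union_eq ?_ ((hfin _).subset (Dnu_subset_torsionW hπ0 hπ1 hν)) (hfin n)]
  · congr 1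
    ext δ
    obtain ⟨b, rfl⟩ := mkW_surjective δ
    simp only [Set.mem_union, SetLike.mem_coe, mkW_mem_torsionW, mkW_mem_Dnu hπ0 hπ1 hν]
    constructor
    · rintro (h | h)
      · exact h.le
      · rw [pow_succ', mul_assoc]
        exact mul_le_one₀ hπ1.le (by positivity) h
    · intro h
      by_contra! h'
      apply h'.1
      have := abs_eq_one_of_lt hπ0 hπ1 hdisc (x := π ^ (n + 1) * b) (by simpa using h) ?_
      · simpa using this
      · have := mul_lt_mul_of_pos_left h'.2 hp
        simpa [pow_succ', mul_assoc] using this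
  · rw [Set.disjoint_left]
    intro δ h1 h2
    obtain ⟨b, rfl⟩ := mkW_surjective δ
    rw [mkW_mem_Dnu hπ0 hπ1 hν] at h1
    rw [SetLike.mem_coe, mkW_mem_torsionW] at h2
    rw [pow_succ', mul_assoc] at h1
    have := mul_lt_one_of_nonneg_of_lt_one_left hp.le hπ1 h2
    linarith

/-- The function `π^{-ν}u ↦ ξ(u)` on `W`, extended by zero. -/
def charW (na : ∀ x y : E, abs (x + y) ≤ max (abs x) (abs y)) (π : F) (ν : ℕ) (ξ : F → E)
    (δ : Wq E abs na F) : E :=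
  if δ ∈ Dnu E abs na F π ν then ξ (π ^ ν * Quotient.out δ) else 0

theorem charW_inv (ν : ℕ) (ξ : F → E) :
    charW na π ν (fun x => (ξ x)⁻¹) = (charW na π ν ξ)⁻¹ := by
  ext δ
  simp only [charW, Pi.inv_apply]
  split_ifs <;> simp

theorem charW_mkW (hπ0 : π ≠ 0) (hπ1 : abs (π : E) < 1) {ξ : F → E} {ν : ℕ} (hν : 1 ≤ ν)
    (hξmul : ∀ u v : F, abs (u : E) = 1 → abs (v : E) = 1 → ξ (u * v) = ξ u * ξ v)
    (hξcond : ∀ u : F, abs (u : E) = 1 → abs ((u : E) - 1) ≤ abs (π : E) ^ ν → ξ u = 1)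
    {b : F} (hb : abs (π : E) ^ ν * abs (b : E) = 1) :
    charW na π ν ξ (mkW E abs na F b) = ξ (π ^ ν * b) := by
  have hp : 0 < abs (π : E) := abs.pos (by simpa using hπ0)
  have hb0 : b ≠ 0 := by rintro rfl; simp at hb
  have hb0' : (b : E) ≠ 0 := by simpa using hb0
  rw [charW, if_pos ((mkW_mem_Dnu hπ0 hπ1 hν b).2 hb)]
  obtain ⟨o, ho, ho'⟩ := exists_out_mkW (na := na) b
  rw [ho', show π ^ ν * (b + o) = (π ^ ν * b) * (1 + o / b) by field_simp]
  have h1 : abs ((o : E) / b) ≤ abs (π : E) ^ ν := by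
    rw [map_div₀, div_le_iff₀ (abs.pos hb0'), hb]
    exact ho
  have h2 : abs ((o : E) / b) < abs (1 : E) := by
    rw [map_one]
    exact h1.trans_lt (pow_lt_one₀ hp.le hπ1 (by omega))
  have h3 : abs ((1 + o / b : F) : E) = 1 := by
    have := abs_add_eq_left na h2
    rw [map_one] at this
    simpa using this
  rw [hξmul _ _ (by simpa using hb) h3, hξcond _ h3 (by simpa using h1), mul_one]

theorem charW_unitEquiv (hπ0 : π ≠ 0) (hπ1 : abs (π : E) < 1) {ξ : F → E} {ν : ℕ} (hν : 1 ≤ ν)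
    (hξmul : ∀ u v : F, abs (u : E) = 1 → abs (v : E) = 1 → ξ (u * v) = ξ u * ξ v)
    (hξcond : ∀ u : F, abs (u : E) = 1 → abs ((u : E) - 1) ≤ abs (π : E) ^ ν → ξ u = 1)
    (u : F) (hu : abs (u : E) = 1) (δ : Wq E abs na F) :
    charW na π ν ξ (unitEquiv na u hu δ) = ξ u * charW na π ν ξ δ := by
  obtain ⟨b, rfl⟩ := mkW_surjective δ
  rw [unitEquiv_mkW]
  have hub : abs (π : E) ^ ν * abs ((u * b : F) : E) = abs (π : E) ^ ν * abs (b : E) := by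
    simp [hu]
  by_cases hb : abs (π : E) ^ ν * abs (b : E) = 1
  · rw [charW_mkW hπ0 hπ1 hν hξmul hξcond (hub.trans hb),
      charW_mkW hπ0 hπ1 hν hξmul hξcond hb, ← hξmul u _ hu (by simpa using hb)]
    congr 1
    ring
  · rw [charW, if_neg (by rwa [mkW_mem_Dnu hπ0 hπ1 hν, hub]), charW,
      if_neg (by rwa [mkW_mem_Dnu hπ0 hπ1 hν]), mul_zero]

theorem isPrimitiveOn_charW (hπ0 : π ≠ 0) (hπ1 : abs (π : E) < 1)
    (hdisc : ∀ x : F, x ≠ 0 → ∃ k : ℤ, abs (x : E) = abs (π : E) ^ k)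
    {ξ : F → E} {ν : ℕ} (hν : 1 ≤ ν)
    (hξmul : ∀ u v : F, abs (u : E) = 1 → abs (v : E) = 1 → ξ (u * v) = ξ u * ξ v)
    (hξne : ∀ u : F, abs (u : E) = 1 → ξ u ≠ 0)
    (hξcond : ∀ u : F, abs (u : E) = 1 → abs ((u : E) - 1) ≤ abs (π : E) ^ ν → ξ u = 1)
    (hξnontriv : ∃ u : F, abs (u : E) = 1 ∧ abs ((u : E) - 1) ≤ abs (π : E) ^ (ν - 1) ∧
      ξ u ≠ 1) (hD : (Dnu E abs na F π ν).Finite) :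
    IsPrimitiveOn (torsionW na hπ1.le 1) (torsionW na hπ1.le ν) hD.toFinset
      (charW na π ν ξ) (ξ (-1)) := by
  have hp : 0 < abs (π : E) := abs.pos (by simpa using hπ0)
  have scale := charW_unitEquiv (na := na) hπ0 hπ1 hν hξmul hξcond
  refine ⟨fun δ => ?_, fun δ hδ => ?_, fun δ hδ => ?_, fun δ => ?_, fun γ hγ t ht => ?_,
    fun γ hγ hγ0 t ht ht0 => ?_, ?_⟩
  · obtain ⟨b, rfl⟩ := mkW_surjective δ
    rw [Set.Finite.mem_toFinset]
    constructor
    · intro h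
      by_contra h'
      exact h (if_neg h')
    · intro h
      rw [charW, if_pos h]
      rw [← mkW_out (mkW E abs na F b), mkW_mem_Dnu hπ0 hπ1 hν] at h
      exact hξne _ (by simpa using h)
  · exact Dnu_subset_torsionW hπ0 hπ1 hν (hD.mem_toFinset.1 hδ)
  · obtain ⟨b, rfl⟩ := mkW_surjective δ
    rw [mkW_mem_torsionW] at hδ ⊢
    refine le_trans (mul_le_mul_of_nonneg_right ?_ (abs.nonneg _)) hδ
    exact pow_le_pow_of_le_one hp.le hπ1.le hν
  · rw [← scale (-1) (by simp)]
    obtain ⟨b, rfl⟩ := mkW_surjective δ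
    rw [unitEquiv_mkW, ← map_neg, neg_one_mul]
  · obtain ⟨b, rfl⟩ := mkW_surjective γ
    obtain ⟨s, rfl⟩ := mkW_surjective t
    rw [mkW_mem_torsionW] at hγ ht
    have hlt : abs (s : E) < abs (b : E) := by
      rw [pow_one] at hγ ht
      exact lt_of_mul_lt_mul_left (ht.trans_lt (not_le.1 hγ)) hp.le
    have hb0 : b ≠ 0 := by
      rintro rfl
      simp at hγ
    have hb0' : (b : E) ≠ 0 := by simpa using hb0
    have hu : abs (((b + s) / b : F) : E) = 1 := by
      have := abs_add_eq_left na hlt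
      simp [map_div₀, this, hb0']
    refine ⟨unitEquiv na _ hu, ξ ((b + s) / b), hξne _ hu, scale _ hu, ?_⟩
    rw [unitEquiv_mkW, div_mul_cancel₀ _ hb0, map_add]
  · obtain ⟨b, rfl⟩ := mkW_surjective γ
    obtain ⟨s, rfl⟩ := mkW_surjective t
    have key (c : F) (hc : mkW E abs na F c ∈ torsionW na hπ1.le 1)
        (hc0 : mkW E abs na F c ≠ 0) : abs (π : E) * abs (c : E) = 1 := by
      rw [mkW_mem_torsionW, pow_one] at hc
      rw [Ne, mkW_eq_zero, not_le] at hc0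
      have := abs_eq_one_of_lt hπ0 hπ1 hdisc (x := π * c) (by simpa using hc)
        (by simpa using lt_mul_of_one_lt_right hp hc0)
      simpa using this
    have hb := key b hγ hγ0
    have hs := key s ht ht0
    have hb0 : b ≠ 0 := by rintro rfl; simp at hb
    have hbs : abs (s : E) = abs (b : E) := mul_left_cancel₀ hp.ne' (hs.trans hb.symm)
    have hb0' : (b : E) ≠ 0 := by simpa using hb0
    have hu : abs ((s / b : F) : E) = 1 := by simp [map_div₀, hbs, hb0']
    refine ⟨unitEquiv na _ hu, ξ (s / b), hξne _ hu, scale _ hu, ?_⟩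
    rw [unitEquiv_mkW, div_mul_cancel₀ _ hb0]
  · obtain ⟨u, hu, hu1, hξu⟩ := hξnontriv
    refine ⟨unitEquiv na u hu, ξ u, hξne u hu, hξu, scale u hu, fun t => ?_, fun δ hδ => ?_⟩
    · obtain ⟨b, rfl⟩ := mkW_surjective t
      rw [unitEquiv_mkW, mkW_mem_torsionW, mkW_mem_torsionW]
      simp [hu]
    · obtain ⟨b, rfl⟩ := mkW_surjective δ
      rw [unitEquiv_mkW, ← map_sub, mkW_mem_torsionW]
      rw [mkW_mem_torsionW] at hδ
      refine le_trans ?_ hδ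
      rw [show u * b - b = (u - 1) * b by ring]
      have hsplit : abs (π : E) ^ ν = abs (π : E) * abs (π : E) ^ (ν - 1) := by
        rw [← pow_succ', Nat.sub_add_cancel hν]
      have h1 : abs (((u - 1) * b : F) : E) = abs ((u : E) - 1) * abs (b : E) := by simp
      rw [hsplit, h1, pow_one, mul_assoc]
      gcongr

theorem psi_out_mkW {ψ : F → E} (hψadd : ∀ x y : F, ψ (x + y) = ψ x * ψ y)
    (hψO : ∀ x : F, abs (x : E) ≤ 1 → ψ x = 1) (b : F) :
    ψ (Quotient.out (mkW E abs na F b)) = ψ b := by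
  obtain ⟨o, ho, h⟩ := exists_out_mkW (na := na) b
  rw [h, hψadd, hψO o ho, mul_one]

theorem Eop_eq_convOp (ψ ξ : F → E) (ν q : ℕ) (hD : (Dnu E abs na F π ν).Finite) :
    Eop E abs na F π ψ ξ ν q = convOp hD.toFinset
      (fun δ : Wq E abs na F => ψ (Quotient.out δ)) (charW na π ν ξ) ((q : E) ^ ν) := by
  ext f β
  rw [Eop, gauss, convOp, finsum_mem_eq_finite_toFinset_sum _ hD,
    finsum_mem_eq_finite_toFinset_sum _ hD]
  congr 1
  · refine congrArg (· / (q : E) ^ ν) (Finset.sum_congr rfl fun δ hδ => ?_)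
    rw [charW, if_pos (hD.mem_toFinset.1 hδ)]
  · refine Finset.sum_congr rfl fun δ hδ => ?_
    rw [charW, if_pos (hD.mem_toFinset.1 hδ)]

theorem finsum_torsionW_one (hπ : abs (π : E) ≤ 1) [Fintype (torsionW na hπ 1)]
    (g : Wq E abs na F → E) (γ : Wq E abs na F) :
    ∑ᶠ (t : Wq E abs na F) (_ : pmulW E abs na F π hπ t = pmulW E abs na F π hπ γ), g t =
      ∑ t : torsionW na hπ 1, g (γ + t) := by
  rw [← finsum_eq_sum_of_fintype, ← finsum_mem_range (f := g)
    (g := fun t : torsionW na hπ 1 => γ + (t : Wq E abs na F))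
    ((add_right_injective γ).comp Subtype.val_injective)]
  refine congrArg finsum (funext fun t => ?_)
  refine finsum_congr_Prop (f := fun _ => g t) (propext ?_) fun _ => rfl
  simp only [Set.mem_range, Subtype.exists, mem_torsionW_one, exists_prop]
  constructor
  · intro h
    exact ⟨t - γ, by rw [map_sub, h, sub_self], by abel⟩
  · rintro ⟨s, hs, rfl⟩
    rw [map_add, hs, add_zero]

end LocalField

/-- for a nontrivial character `ξ` of `U_F` of conductor `ν ≥ 1`:
(a) `E_ξ E_{ξ⁻¹} = E_{ξ⁻¹} E_ξ` is the projection of `𝒞` onto `𝒞₀` along `𝒞₁`;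
(b) `S E_ξ = 0`; (c) `E_ξ E_{ξ⁻¹} E_ξ = E_ξ` (Lemma 4.1(ii),(iii) of the paper). -/
theorem stmt16 [CharZero E]
    (abs : AbsoluteValue E ℝ)
    (na : ∀ x y : E, abs (x + y) ≤ max (abs x) (abs y))
    (F : Subfield E) (π : F)
    (hπ0 : π ≠ 0) (hπ1 : abs (π : E) < 1)
    (hdisc : ∀ x : F, x ≠ 0 → ∃ k : ℤ, abs (x : E) = abs (π : E) ^ k)
    -- the residue field has `q` elements
    (q : ℕ) (hq : 0 < q)
    (hcard : ∀ γ : Wq E abs na F,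
      Nat.card {β : Wq E abs na F // pmulW E abs na F π hπ1.le β = γ} = q)
    -- `ψ` is an additive character of `F`, trivial on `O_F`, under which `O_F` is its own
    -- annihilator:
    (ψ : F → E)
    (hψadd : ∀ x y : F, ψ (x + y) = ψ x * ψ y)
    (hψO : ∀ x : F, abs (x : E) ≤ 1 → ψ x = 1)
    (hψann : ∀ b : F, 1 < abs (b : E) → ∃ x : F, abs (x : E) ≤ 1 ∧ ψ (b * x) ≠ 1)
    -- `ξ` is a character of `U_F` with values in `E^×`, of conductor `ν ≥ 1`:
    (ξ : F → E) (ν : ℕ) (hν : 1 ≤ ν)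
    (hξmul : ∀ u v : F, abs (u : E) = 1 → abs (v : E) = 1 → ξ (u * v) = ξ u * ξ v)
    (hξne : ∀ u : F, abs (u : E) = 1 → ξ u ≠ 0)
    (hξcond : ∀ u : F, abs (u : E) = 1 → abs ((u : E) - 1) ≤ abs (π : E) ^ ν → ξ u = 1)
    (hξnontriv : ∃ u : F, abs (u : E) = 1 ∧ abs ((u : E) - 1) ≤ abs (π : E) ^ (ν - 1) ∧
      ξ u ≠ 1)
    (f : Wq E abs na F → E) (hf : {β | f β ≠ 0}.Finite) :
    -- (a)
    (Eop E abs na F π ψ ξ ν q (Eop E abs na F π ψ (fun x => (ξ x)⁻¹) ν q f) =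
      Eop E abs na F π ψ (fun x => (ξ x)⁻¹) ν q (Eop E abs na F π ψ ξ ν q f)) ∧
    predC0 E abs na F π hπ1.le
      (Eop E abs na F π ψ ξ ν q (Eop E abs na F π ψ (fun x => (ξ x)⁻¹) ν q f)) ∧
    predC1 E abs na F π hπ1.le
      (f - Eop E abs na F π ψ ξ ν q (Eop E abs na F π ψ (fun x => (ξ x)⁻¹) ν q f)) ∧
    -- (b)
    (∀ β : Wq E abs na F, Sop E abs na F π hπ1.le (Eop E abs na F π ψ ξ ν q f) β = 0) ∧
    -- (c)
    (Eop E abs na F π ψ ξ ν q (Eop E abs na F π ψ (fun x => (ξ x)⁻¹) ν q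
        (Eop E abs na F π ψ ξ ν q f)) =
      Eop E abs na F π ψ ξ ν q f) := by
  have hp : 0 < abs (π : E) := abs.pos (by simpa using hπ0)
  have hfin (n : ℕ) : Finite (torsionW na hπ1.le n) := Nat.finite_of_card_ne_zero (by
    rw [card_torsionW hπ1.le hq hcard]
    exact (pow_pos hq _).ne')
  have hD : (Dnu E abs na F π ν).Finite :=
    Set.Finite.subset (hfin ν) (Dnu_subset_torsionW hπ0 hπ1 hν)
  let _ : Fintype (torsionW na hπ1.le 1) := Fintype.ofFinite _
  let _ : Fintype (torsionW na hπ1.le ν) := Fintype.ofFinite _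
  have hTcard : Fintype.card (torsionW na hπ1.le 1) = q := by
    rw [← Nat.card_eq_fintype_card, card_torsionW hπ1.le hq hcard, pow_one]
  have hDcard : hD.toFinset.card + q ^ (ν - 1) = q ^ ν := by
    rw [← Set.ncard_eq_toFinset_card _ hD]
    exact ncard_Dnu_add hπ0 hπ1 hdisc hq hcard hν
  have hDne : hD.toFinset.Nonempty := by
    refine ⟨mkW E abs na F (π ^ ν)⁻¹, hD.mem_toFinset.2 ?_⟩
    rw [mkW_mem_Dnu hπ0 hπ1 hν]
    simp [map_inv₀, hp.ne']
  set Ψ : Wq E abs na F → E := fun δ => ψ (Quotient.out δ)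
  have hΨmk (b : F) : Ψ (mkW E abs na F b) = ψ b := psi_out_mkW hψadd hψO b
  have hΨ0 : Ψ 0 = 1 := by
    rw [← map_zero (mkW E abs na F), hΨmk]
    exact hψO 0 (by simp)
  have hΨadd (x y : Wq E abs na F) : Ψ (x + y) = Ψ x * Ψ y := by
    obtain ⟨a, rfl⟩ := mkW_surjective x
    obtain ⟨b, rfl⟩ := mkW_surjective y
    rw [← map_add, hΨmk, hΨmk, hΨmk, hψadd]
  have hΨT : ∃ t ∈ torsionW na hπ1.le 1, Ψ t ≠ 1 := by
    obtain ⟨x, hx, hx1⟩ := hψann π⁻¹ (by simpa [map_inv₀] using (one_lt_inv₀ hp).2 hπ1)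
    refine ⟨mkW E abs na F (π⁻¹ * x), ?_, by rwa [hΨmk]⟩
    rw [mkW_mem_torsionW]
    simpa [map_inv₀, hp.ne', hπ0] using hx
  have H := isPrimitiveOn_charW (na := na) hπ0 hπ1 hdisc hν hξmul hξne hξcond hξnontriv hD
  have h1 := H.convOp_convOp_inv hν hTcard hDcard hDne hΨ0 hΨadd hΨT
  have h2 := H.inv.convOp_convOp_inv hν hTcard hDcard hDne hΨ0 hΨadd hΨT
  rw [inv_inv] at h2
  simp only [Eop_eq_convOp _ _ _ _ hD, charW_inv]
  refine ⟨?_, fun β => ?_, fun β β' hβ => ?_, fun β => ?_, ?_⟩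
  · ext β
    rw [h1, h2]
  · have := finsum_torsionW_one (na := na) hπ1.le (fun t => convOp hD.toFinset Ψ (charW na π ν ξ)
      ((q : E) ^ ν) (convOp hD.toFinset Ψ (charW na π ν ξ)⁻¹ ((q : E) ^ ν) f) (β + t)) 0
    rw [map_zero] at this
    rw [this]
    simp only [zero_add]
    exact H.sum_convOp_eq_zero _ _ _ _
  · rw [Pi.sub_apply, Pi.sub_apply, h1, h1, sub_sub_cancel, sub_sub_cancel]
    congr 1
    have hs : β - β' ∈ torsionW na hπ1.le 1 := by
      rw [mem_torsionW_one, map_sub, hβ, sub_self]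
    rw [← Equiv.sum_comp (Equiv.addLeft (⟨β - β', hs⟩ : torsionW na hπ1.le 1))]
    refine Finset.sum_congr rfl fun t _ => ?_
    congr 1
    simp only [Equiv.coe_addLeft, AddSubgroup.coe_add]
    abel
  · have hne : Nonempty {α : Wq E abs na F // pmulW E abs na F π hπ1.le α = β} :=
      (Nat.card_pos_iff.1 (by rw [hcard]; exact hq)).1
    obtain ⟨α, rfl⟩ := hne
    rw [Sop, finsum_torsionW_one]
    exact H.sum_convOp_eq_zero _ _ _ _
  · ext β
    rw [h1, ← Equiv.sum_comp (Equiv.neg (torsionW na hπ1.le 1))]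
    simp only [Equiv.neg_apply, AddSubgroup.coe_neg, sub_neg_eq_add]
    rw [H.sum_convOp_eq_zero, mul_zero, sub_zero]

end BS
end
end
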